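/- arXiv:2101.11257 — 2 statements merged into one kernel-verified Lean document; each statement's English description precedes it below -/
import Mathlib

section
/- Assume V is of class C¹ on ℝ^n and F is of class C². If for some ε > 0 one has C_P(μ) · sup_x (A F − (1/2)|∇F|²)_+(x) ≤ 2(1 − ε), where A = Δ − ∇V·∇ and u_+ = max(u,0), then C_P(μ_F) ≤ C_P(μ)/ε. -/
open MeasureTheory Real Set
open scoped ENNReal RealInnerProductSpace Pointwise Matrix

noncomputable section

/-- Euclidean space ℝ^n. -/
abbrev En (n : ℕ) := EuclideanSpace ℝ (Fin n)

/-- Test functions: smooth, bounded and Lipschitz. -/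
def IsTestFun {n : ℕ} (f : En n → ℝ) : Prop :=
  ContDiff ℝ (⊤ : ℕ∞) f ∧ (∃ M, ∀ x, |f x| ≤ M) ∧ ∃ L, LipschitzWith L f

/-- `μ` satisfies a Poincaré inequality with constant `C`. -/
def PoincareLE {n : ℕ} (μ : Measure (En n)) (C : ℝ) : Prop :=
  ∀ f : En n → ℝ, IsTestFun f →
    (∫ x, (f x) ^ 2 ∂μ) - (∫ x, f x ∂μ) ^ 2 ≤ C * ∫ x, ‖gradient f x‖ ^ 2 ∂μ

/-- `μ` satisfies a logarithmic Sobolev inequality with constant `C`. -/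
def LogSobolevLE {n : ℕ} (μ : Measure (En n)) (C : ℝ) : Prop :=
  ∀ f : En n → ℝ, IsTestFun f →
    (∫ x, (f x) ^ 2 * Real.log ((f x) ^ 2) ∂μ)
        - (∫ x, (f x) ^ 2 ∂μ) * Real.log (∫ x, (f x) ^ 2 ∂μ)
      ≤ C * ∫ x, ‖gradient f x‖ ^ 2 ∂μ

/-- `μ` satisfies an L¹-Poincaré inequality (around the mean) with constant `C`. -/
def CheegerMeanLE {n : ℕ} (μ : Measure (En n)) (C : ℝ) : Prop :=
  ∀ f : En n → ℝ, IsTestFun f →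
    ∫ x, |f x - ∫ y, f y ∂μ| ∂μ ≤ C * ∫ x, ‖gradient f x‖ ∂μ

/-- `m` is a median of `f` under `μ`. -/
def IsMedian {n : ℕ} (μ : Measure (En n)) (f : En n → ℝ) (m : ℝ) : Prop :=
  ENNReal.ofReal (1 / 2) ≤ μ {x | f x ≤ m} ∧ ENNReal.ofReal (1 / 2) ≤ μ {x | m ≤ f x}

/-- `μ` satisfies a Cheeger inequality (around medians) with constant `C`. -/
def CheegerMedianLE {n : ℕ} (μ : Measure (En n)) (C : ℝ) : Prop :=
  ∀ f : En n → ℝ, IsTestFun f → ∀ m : ℝ, IsMedian μ f m →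
    ∫ x, |f x - m| ∂μ ≤ C * ∫ x, ‖gradient f x‖ ∂μ

/-- The perturbed (normalized) measure `μ_F = Z_F⁻¹ e^{-F} μ`. -/
def perturb {n : ℕ} (μ : Measure (En n)) (F : En n → ℝ) : Measure (En n) :=
  (ENNReal.ofReal (∫ x, Real.exp (-F x) ∂μ))⁻¹ •
    μ.withDensity fun x => ENNReal.ofReal (Real.exp (-F x))

/-- Topological support of a measure. -/
def measSupport {n : ℕ} (μ : Measure (En n)) : Set (En n) :=
  {x | ∀ U ∈ nhds x, 0 < μ U}

/-- `μ` is log-concave: it has density `e^{-W}` on a convex set, with `W` convex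
(equivalently, density `e^{-W}` with `W : ℝⁿ → ℝ ∪ {+∞}` convex). -/
def IsLogConcave {n : ℕ} (μ : Measure (En n)) : Prop :=
  ∃ (s : Set (En n)) (W : En n → ℝ), Convex ℝ s ∧ ConvexOn ℝ s W ∧
    μ = volume.withDensity (s.indicator fun x => ENNReal.ofReal (Real.exp (-W x)))

/-- The Laplacian of `F`. -/
def laplacian {n : ℕ} (F : En n → ℝ) (x : En n) : ℝ :=
  ∑ i : Fin n,
    fderiv ℝ (fun y => fderiv ℝ F y (EuclideanSpace.single i (1 : ℝ))) x
      (EuclideanSpace.single i (1 : ℝ))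

/-- The generator `A F = ΔF - ∇V·∇F` associated with `μ = e^{-V} dx`. -/
def genA {n : ℕ} (V F : En n → ℝ) (x : En n) : ℝ :=
  laplacian F x - ⟪gradient V x, gradient F x⟫

/-- The centered Gaussian measure on ℝ^n with covariance matrix `σ² Id`. -/
def gaussMeasure (n : ℕ) (σ : ℝ) : Measure (En n) :=
  volume.withDensity fun x =>
    ENNReal.ofReal ((2 * π * σ ^ 2) ^ (-(n : ℝ) / 2) * Real.exp (-‖x‖ ^ 2 / (2 * σ ^ 2)))

/-- Convolution of two measures. -/
def mconv {n : ℕ} (μ ν : Measure (En n)) : Measure (En n) :=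
  (μ.prod ν).map fun p => p.1 + p.2

/-- Concentration profile of `μ`. -/
def concProfile {n : ℕ} (μ : Measure (En n)) (r : ℝ) : ℝ :=
  sSup {t | ∃ A : Set (En n), MeasurableSet A ∧ (1 : ℝ) / 2 ≤ (μ A).toReal ∧
    t = 1 - (μ (A + Metric.ball (0 : En n) r)).toReal}

/-- Generalized inverse of the concentration profile. -/
def concInv {n : ℕ} (μ : Measure (En n)) (s : ℝ) : ℝ :=
  sInf {r | 0 < r ∧ concProfile μ r ≤ s}

/-- The Hessian matrix of `V` at `x`. -/
def hessMat {n : ℕ} (V : En n → ℝ) (x : En n) : Matrix (Fin n) (Fin n) ℝ :=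
  fun i j =>
    fderiv ℝ (fun y => fderiv ℝ V y (EuclideanSpace.single j (1 : ℝ))) x
      (EuclideanSpace.single i (1 : ℝ))

end


section PoincarePerturbation

open Filter Topology ContDiff

variable {n : ℕ}

lemma norm_gradient_eq_norm_fderiv (f : En n → ℝ) (x : En n) :
    ‖gradient f x‖ = ‖fderiv ℝ f x‖ := by
  rw [← toDual_gradient, LinearIsometryEquiv.norm_map]

lemma inner_gradient_eq_fderiv (f : En n → ℝ) (x y : En n) :
    ⟪gradient f x, y⟫ = fderiv ℝ f x y := by
  rw [← toDual_gradient, InnerProductSpace.toDual_apply_apply]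

lemma integral_fderiv_apply_eq_zero {u : En n → ℝ} (hu : ContDiff ℝ 1 u)
    (hc : HasCompactSupport u) (v : En n) : ∫ x, fderiv ℝ u x v = 0 := by
  have hi : Integrable (fun x => fderiv ℝ u x v) := by
    refine Continuous.integrable_of_hasCompactSupport ?_ (hc.fderiv_apply (𝕜 := ℝ) v)
    exact (hu.continuous_fderiv one_ne_zero).clm_apply continuous_const
  have h := integral_mul_fderiv_eq_neg_fderiv_mul_of_integrable (μ := (volume : Measure (En n)))
    (f := u) (g := fun _ => (1 : ℝ)) (v := v) (by simpa using hi) (by simp)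
    (by simpa using hu.continuous.integrable_of_hasCompactSupport hc)
    (fun x _ => hu.differentiable one_ne_zero x) (fun x _ => differentiableAt_const _)
  simpa using h

lemma contDiff_one_fderiv_apply {F : En n → ℝ} (hF : ContDiff ℝ 2 F) (v : En n) :
    ContDiff ℝ 1 fun x => fderiv ℝ F x v :=
  (hF.fderiv_right (m := 1) (by norm_num)).clm_apply contDiff_const

lemma continuous_laplacian {F : En n → ℝ} (hF : ContDiff ℝ 2 F) : Continuous (laplacian F) := by
  unfold laplacian
  exact continuous_finsetSum _ fun i _ =>
    ((contDiff_one_fderiv_apply hF _).continuous_fderiv one_ne_zero).clm_apply continuous_const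

lemma continuous_gradient {F : En n → ℝ} (hF : ContDiff ℝ 1 F) : Continuous (gradient F) :=
  (InnerProductSpace.toDual ℝ (En n)).symm.continuous.comp (hF.continuous_fderiv one_ne_zero)

lemma continuous_genA {V F : En n → ℝ} (hV : ContDiff ℝ 1 V) (hF : ContDiff ℝ 2 F) :
    Continuous (genA V F) :=
  (continuous_laplacian hF).sub
    ((continuous_gradient hV).inner (continuous_gradient (hF.of_le one_le_two)))

/-- The Green identity for a compactly supported factor. -/
lemma integral_mul_laplacian_add_inner_gradient {u F : En n → ℝ} (hu : ContDiff ℝ 1 u)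
    (hc : HasCompactSupport u) (hF : ContDiff ℝ 2 F) :
    ∫ x, (u x * laplacian F x + ⟪gradient u x, gradient F x⟫) = 0 := by
  have hw (i : Fin n) : ContDiff ℝ 1
      fun x => u x * fderiv ℝ F x (EuclideanSpace.single i (1 : ℝ)) :=
    hu.mul (contDiff_one_fderiv_apply hF _)
  have hwc (i : Fin n) : HasCompactSupport
      fun x => u x * fderiv ℝ F x (EuclideanSpace.single i (1 : ℝ)) := hc.mul_right
  have key (x : En n) : u x * laplacian F x + ⟪gradient u x, gradient F x⟫ =
      ∑ i : Fin n, fderiv ℝ (fun y => u y * fderiv ℝ F y (EuclideanSpace.single i (1 : ℝ))) x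
        (EuclideanSpace.single i (1 : ℝ)) := by
    have hd (i : Fin n) :
        fderiv ℝ (fun y => u y * fderiv ℝ F y (EuclideanSpace.single i (1 : ℝ))) x
          (EuclideanSpace.single i (1 : ℝ)) =
        u x * fderiv ℝ (fun y => fderiv ℝ F y (EuclideanSpace.single i (1 : ℝ))) x
          (EuclideanSpace.single i (1 : ℝ)) + gradient F x i * gradient u x i := by
      rw [fderiv_fun_mul (hu.differentiable one_ne_zero x)
        ((contDiff_one_fderiv_apply hF _).differentiable one_ne_zero x)]
      simp only [add_apply, smul_apply, smul_eq_mul,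
        ← inner_gradient_eq_fderiv F x, ← inner_gradient_eq_fderiv u x]
      simp only [EuclideanSpace.inner_single_right]
      simp
    simp only [hd, Finset.sum_add_distrib, ← Finset.mul_sum]
    rw [laplacian, PiLp.inner_apply]
    simp
  simp only [key]
  rw [integral_finsetSum]
  · exact Finset.sum_eq_zero fun i _ => integral_fderiv_apply_eq_zero (hw i) (hwc i) _
  · intro i _
    refine Continuous.integrable_of_hasCompactSupport ?_ ((hwc i).fderiv_apply (𝕜 := ℝ) _)
    exact ((hw i).continuous_fderiv one_ne_zero).clm_apply continuous_const

lemma integral_withDensity_exp_neg {ν : Measure (En n)} {V : En n → ℝ} (hV : Continuous V)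
    (g : En n → ℝ) :
    ∫ x, g x ∂(ν.withDensity fun x => ENNReal.ofReal (Real.exp (-V x))) =
      ∫ x, Real.exp (-V x) * g x ∂ν := by
  rw [integral_withDensity_eq_integral_toReal_smul (by fun_prop) (by simp)]
  simp [ENNReal.toReal_ofReal (Real.exp_pos _).le]

lemma integral_mul_genA_add_inner_gradient {μ : Measure (En n)} {V F v : En n → ℝ}
    (hV : ContDiff ℝ 1 V)
    (hμ : μ = volume.withDensity fun x => ENNReal.ofReal (Real.exp (-V x)))
    (hF : ContDiff ℝ 2 F) (hv : ContDiff ℝ 1 v) (hc : HasCompactSupport v) :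
    ∫ x, (v x * genA V F x + ⟪gradient v x, gradient F x⟫) ∂μ = 0 := by
  have hE : ContDiff ℝ 1 fun x => Real.exp (-V x) := hV.neg.exp
  have h := integral_mul_laplacian_add_inner_gradient (hE.mul hv) hc.mul_left hF
  rw [hμ, integral_withDensity_exp_neg hV.continuous, ← h]
  congr 1 with x
  have hdE : HasFDerivAt (fun x => Real.exp (-V x)) (Real.exp (-V x) • -fderiv ℝ V x) x :=
    (hV.differentiable one_ne_zero x).hasFDerivAt.neg.exp
  have hd : fderiv ℝ (fun x => Real.exp (-V x) * v x) x = _ :=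
    (hdE.mul (hv.differentiable one_ne_zero x).hasFDerivAt).fderiv
  simp only [inner_gradient_eq_fderiv, genA, hd]
  simp
  ring

lemma PoincareLE.of_tendsto {μ : Measure (En n)} [IsProbabilityMeasure μ] {C : ℝ}
    (hP : PoincareLE μ C) {g : En n → ℝ} {φ : ℕ → En n → ℝ} {M : ℝ}
    (hφ : ∀ k, ContDiff ℝ ∞ (φ k)) (hM : ∀ k x, |φ k x| ≤ M)
    (hM' : ∀ k x, ‖fderiv ℝ (φ k) x‖ ≤ M)
    (hlim : ∀ x, Tendsto (fun k => φ k x) atTop (𝓝 (g x)))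
    (hlim' : ∀ x, Tendsto (fun k => fderiv ℝ (φ k) x) atTop (𝓝 (fderiv ℝ g x))) :
    (∫ x, (g x) ^ 2 ∂μ) - (∫ x, g x ∂μ) ^ 2 ≤ C * ∫ x, ‖gradient g x‖ ^ 2 ∂μ := by
  have hM0 : 0 ≤ M := (abs_nonneg _).trans (hM 0 0)
  have hcont k : Continuous (φ k) := (hφ k).continuous
  have hcont' k : Continuous (fderiv ℝ (φ k)) :=
    (hφ k).continuous_fderiv (by simp)
  have ht k : IsTestFun (φ k) :=
    ⟨hφ k, ⟨M, hM k⟩, ⟨M.toNNReal, lipschitzWith_of_nnnorm_fderiv_le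
      ((hφ k).differentiable (by simp)) fun x => by
        rw [← NNReal.coe_le_coe, coe_nnnorm, Real.coe_toNNReal _ hM0]; exact hM' k x⟩⟩
  simp only [norm_gradient_eq_norm_fderiv]
  refine le_of_tendsto_of_tendsto' (Tendsto.sub
    (tendsto_integral_of_dominated_convergence (F := fun k x => (φ k x) ^ 2) (fun _ => M ^ 2)
      (fun k => ((hcont k).pow 2).aestronglyMeasurable) (integrable_const _) ?_ ?_)
    (Tendsto.pow (tendsto_integral_of_dominated_convergence (F := fun k x => φ k x) (fun _ => M)
      (fun k => (hcont k).aestronglyMeasurable) (integrable_const _) ?_ ?_) 2))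
    (Tendsto.const_mul C
      (tendsto_integral_of_dominated_convergence (F := fun k x => ‖fderiv ℝ (φ k) x‖ ^ 2)
        (fun _ => M ^ 2) (fun k => ((hcont' k).norm.pow 2).aestronglyMeasurable)
        (integrable_const _) ?_ ?_))
    (fun k => by simpa only [norm_gradient_eq_norm_fderiv] using hP (φ k) (ht k))
  · refine fun k => ae_of_all _ fun x => ?_
    rw [norm_pow]
    exact pow_le_pow_left₀ (norm_nonneg _) (hM k x) 2
  · exact ae_of_all _ fun x => (hlim x).pow 2
  · exact fun k => ae_of_all _ (hM k)
  · exact ae_of_all _ hlim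
  · refine fun k => ae_of_all _ fun x => ?_
    rw [norm_pow, norm_norm]
    exact pow_le_pow_left₀ (norm_nonneg _) (hM' k x) 2
  · exact ae_of_all _ fun x => (hlim' x).norm.pow 2

lemma PoincareLE.of_contDiff_one {μ : Measure (En n)} [IsProbabilityMeasure μ] {C : ℝ}
    (hP : PoincareLE μ C) {g : En n → ℝ} (hg : ContDiff ℝ 1 g) (hc : HasCompactSupport g) :
    (∫ x, (g x) ^ 2 ∂μ) - (∫ x, g x ∂μ) ^ 2 ≤ C * ∫ x, ‖gradient g x‖ ^ 2 ∂μ := by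
  have hg' : Continuous (fderiv ℝ g) := hg.continuous_fderiv one_ne_zero
  obtain ⟨M, hM⟩ := hc.exists_bound_of_continuous hg.continuous
  obtain ⟨M', hM'⟩ := (hc.fderiv (𝕜 := ℝ)).exists_bound_of_continuous hg'
  let b : ℕ → ContDiffBump (0 : En n) := fun k =>
    ⟨1 / (2 * ((k : ℝ) + 1)), 1 / ((k : ℝ) + 1), by positivity, by
      apply one_div_lt_one_div_of_lt <;> linarith [k.cast_nonneg (α := ℝ)]⟩
  have hb : Tendsto (fun k => (b k).rOut) atTop (𝓝 0) :=
    tendsto_one_div_add_atTop_nhds_zero_nat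
  have hfd k x : fderiv ℝ (MeasureTheory.convolution ((b k).normed volume) g
        (ContinuousLinearMap.lsmul ℝ ℝ) volume) x =
      MeasureTheory.convolution ((b k).normed volume) (fderiv ℝ g)
        (ContinuousLinearMap.lsmul ℝ ℝ) volume x := by
    rw [(hc.hasFDerivAt_convolution_right (ContinuousLinearMap.lsmul ℝ ℝ)
      ((b k).contDiff_normed (n := 0)).continuous.locallyIntegrable hg x).fderiv]
    rfl
  have bound {E : Type} [NormedAddCommGroup E] [NormedSpace ℝ E] [CompleteSpace E]
      {f : En n → E} (hf : Continuous f) {K : ℝ} (hK : ∀ x, ‖f x‖ ≤ K) (k : ℕ) (x : En n) :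
      ‖MeasureTheory.convolution ((b k).normed volume) f
        (ContinuousLinearMap.lsmul ℝ ℝ) volume x‖ ≤ 3 * K := by
    have h := (b k).dist_normed_convolution_le (μ := volume) (x₀ := x) (ε := 2 * K)
      hf.aestronglyMeasurable fun y _ => (dist_le_norm_add_norm _ _).trans (by
        linarith [hK x, hK y])
    rw [dist_eq_norm] at h
    linarith [norm_le_norm_sub_add (MeasureTheory.convolution ((b k).normed volume) f
        (ContinuousLinearMap.lsmul ℝ ℝ) volume x) (f x), hK x]
  refine hP.of_tendsto (M := max (3 * M) (3 * M')) (φ := fun k =>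
    MeasureTheory.convolution ((b k).normed volume) g (ContinuousLinearMap.lsmul ℝ ℝ) volume)
    (fun k => (b k).hasCompactSupport_normed.contDiff_convolution_left _ (b k).contDiff_normed
      hg.continuous.locallyIntegrable)
    (fun k x => (bound hg.continuous hM k x).trans (le_max_left _ _))
    (fun k x => ?_)
    (fun x => ContDiffBump.convolution_tendsto_right_of_continuous hb hg.continuous x)
    (fun x => ?_)
  · rw [hfd]
    exact (bound hg' hM' k x).trans (le_max_right _ _)
  · simp only [hfd]
    exact ContDiffBump.convolution_tendsto_right_of_continuous hb hg' x

lemma norm_gradient_mul_exp_sq {h F : En n → ℝ} {x : En n} (hh : DifferentiableAt ℝ h x)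
    (hF : DifferentiableAt ℝ F x) :
    ‖gradient (fun y => h y * Real.exp (-F y / 2)) x‖ ^ 2 =
      Real.exp (-F x) * (‖gradient h x‖ ^ 2 - h x * ⟪gradient h x, gradient F x⟫
        + (h x) ^ 2 * ‖gradient F x‖ ^ 2 / 4) := by
  have hg : gradient (fun y => h y * Real.exp (-F y / 2)) x =
      Real.exp (-F x / 2) • (gradient h x - (h x / 2) • gradient F x) := by
    refine ext_inner_right ℝ fun y => ?_
    have hd : HasFDerivAt (fun y => Real.exp (-F y / 2))
        (Real.exp (-F x / 2) • (2⁻¹ : ℝ) • -fderiv ℝ F x) x := by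
      exact (hF.hasFDerivAt.neg.mul_const (2⁻¹ : ℝ)).exp
    have hd' : fderiv ℝ (fun y => h y * Real.exp (-F y / 2)) x = _ :=
      (hh.hasFDerivAt.mul hd).fderiv
    rw [inner_smul_left, inner_sub_left, inner_smul_left, inner_gradient_eq_fderiv,
      inner_gradient_eq_fderiv, inner_gradient_eq_fderiv, hd']
    simp
    ring
  have he : Real.exp (-F x) = Real.exp (-F x / 2) ^ 2 := by
    rw [← Real.exp_nat_mul]; congr 1; push_cast; ring
  rw [hg, norm_smul, mul_pow, norm_sub_sq_real, inner_smul_right, norm_smul, he, mul_pow]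
  simp only [Real.norm_eq_abs, sq_abs]
  ring

lemma integral_sq_mul_exp_le_of_hasCompactSupport
    {μ : Measure (En n)} [IsProbabilityMeasure μ] {V F h : En n → ℝ} (hV : ContDiff ℝ 1 V)
    (hμ : μ = volume.withDensity fun x => ENNReal.ofReal (Real.exp (-V x)))
    (hF : ContDiff ℝ 2 F) {C ε : ℝ} (hP : PoincareLE μ C) (hC : 0 ≤ C)
    (hcond : ∀ x, C * max (genA V F x - (1 / 2) * ‖gradient F x‖ ^ 2) 0 ≤ 2 * (1 - ε))
    (hh : ContDiff ℝ 1 h) (hc : HasCompactSupport h) :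
    ε * (∫ x, Real.exp (-F x) * (h x) ^ 2 ∂μ) ≤
      C * (∫ x, Real.exp (-F x) * ‖gradient h x‖ ^ 2 ∂μ)
        + (∫ x, h x * Real.exp (-F x / 2) ∂μ) ^ 2 := by
  have hF1 : ContDiff ℝ 1 F := hF.of_le one_le_two
  have hgF := continuous_gradient hF1
  have hgh := continuous_gradient hh
  have hA := continuous_genA hV hF
  have hFc := hF.continuous
  have hhc := hh.continuous
  have hgc : HasCompactSupport (gradient h) := by
    refine (hc.fderiv (𝕜 := ℝ)).comp_left (g := (InnerProductSpace.toDual ℝ (En n)).symm) (by simp)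
  have hsq : HasCompactSupport fun x => (h x) ^ 2 := hc.comp_left (g := (· ^ 2)) (by simp)
  have hgsq : HasCompactSupport fun x => ‖gradient h x‖ ^ 2 :=
    hgc.comp_left (g := (‖·‖ ^ 2)) (by simp)
  let v : En n → ℝ := fun x => (h x) ^ 2 * Real.exp (-F x)
  have hv : ContDiff ℝ 1 v := (hh.pow 2).mul hF1.neg.exp
  have hvc : HasCompactSupport v := hsq.mul_right
  have hibp := integral_mul_genA_add_inner_gradient hV hμ hF hv hvc
  have hpoinc := hP.of_contDiff_one (g := fun x => h x * Real.exp (-F x / 2))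
    (hh.mul (hF1.neg.div_const 2).exp) hc.mul_right
  have hi1 : Integrable (fun x => Real.exp (-F x) * (h x) ^ 2) μ :=
    (by fun_prop : Continuous _).integrable_of_hasCompactSupport hsq.mul_left
  have hi2 : Integrable (fun x => Real.exp (-F x) * ‖gradient h x‖ ^ 2) μ :=
    (by fun_prop : Continuous _).integrable_of_hasCompactSupport hgsq.mul_left
  have hi3 : Integrable (fun x => v x * genA V F x + ⟪gradient v x, gradient F x⟫) μ := by
    have hgv := continuous_gradient hv
    have hvcont := hv.continuous
    refine Continuous.integrable_of_hasCompactSupport (by fun_prop) (hvc.mul_right.add ?_)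
    simp only [inner_gradient_eq_fderiv]
    refine (hvc.fderiv (𝕜 := ℝ)).mono fun x hx h0 => hx ?_
    simp [h0]
  have hpt (x : En n) : C * ‖gradient (fun y => h y * Real.exp (-F y / 2)) x‖ ^ 2 ≤
      C * (Real.exp (-F x) * ‖gradient h x‖ ^ 2) + (1 - ε) * (Real.exp (-F x) * (h x) ^ 2)
        - C / 2 * (v x * genA V F x + ⟪gradient v x, gradient F x⟫) := by
    have hd := hh.differentiable one_ne_zero x
    have hdF := hF1.differentiable one_ne_zero x
    rw [norm_gradient_mul_exp_sq hd hdF]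
    have hdv : ⟪gradient v x, gradient F x⟫ = Real.exp (-F x) *
        (2 * h x * ⟪gradient h x, gradient F x⟫ - (h x) ^ 2 * ‖gradient F x‖ ^ 2) := by
      have hdv' : fderiv ℝ v x = _ :=
        ((hd.hasFDerivAt.pow 2).mul hdF.hasFDerivAt.neg.exp).fderiv
      have hFF : fderiv ℝ F x (gradient F x) = ‖gradient F x‖ ^ 2 := by
        rw [← inner_gradient_eq_fderiv, real_inner_self_eq_norm_sq]
      rw [inner_gradient_eq_fderiv, inner_gradient_eq_fderiv, hdv']
      simp [hFF]
      ring
    rw [hdv]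
    have hle : C * (genA V F x - (1 / 2) * ‖gradient F x‖ ^ 2) ≤ 2 * (1 - ε) :=
      (mul_le_mul_of_nonneg_left (le_max_left _ _) hC).trans (hcond x)
    have := mul_le_mul_of_nonneg_left hle
      (mul_nonneg (Real.exp_pos (-F x)).le (sq_nonneg (h x)))
    simp only [v]
    linarith
  have hint := integral_mono_of_nonneg (μ := μ) (ae_of_all _ fun x => by positivity)
    (((hi2.const_mul C).add (hi1.const_mul (1 - ε))).sub (hi3.const_mul (C / 2)))
    (ae_of_all _ hpt)
  rw [integral_sub' ((hi2.const_mul C).add (hi1.const_mul (1 - ε))) (hi3.const_mul (C / 2)),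
    integral_add' (hi2.const_mul C) (hi1.const_mul (1 - ε))] at hint
  simp only [integral_const_mul, hibp] at hint
  have he : ∫ x, (h x * Real.exp (-F x / 2)) ^ 2 ∂μ = ∫ x, Real.exp (-F x) * (h x) ^ 2 ∂μ := by
    congr 1 with x
    rw [mul_pow, ← Real.exp_nat_mul, mul_comm]
    congr 2; push_cast; ring
  rw [he] at hpoinc
  linarith

lemma exists_cutoff_seq (n : ℕ) : ∃ (χ : ℕ → En n → ℝ) (K : ℝ),
    (∀ k, ContDiff ℝ ∞ (χ k)) ∧ (∀ k, HasCompactSupport (χ k)) ∧ (∀ k x, |χ k x| ≤ 1) ∧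
    (∀ k x, ‖fderiv ℝ (χ k) x‖ ≤ K * (1 / ((k : ℝ) + 1))) ∧
    (∀ x, Tendsto (fun k => χ k x) atTop (𝓝 1)) := by
  let b : ContDiffBump (0 : En n) := ⟨1, 2, one_pos, one_lt_two⟩
  have hb : ContDiff ℝ ∞ b := b.contDiff
  obtain ⟨K, hK⟩ := (b.hasCompactSupport.fderiv (𝕜 := ℝ)).exists_bound_of_continuous
    (hb.continuous_fderiv (by simp))
  have hpos (k : ℕ) : (0 : ℝ) < 1 / ((k : ℝ) + 1) := by positivity
  refine ⟨fun k x => b ((1 / ((k : ℝ) + 1)) • x), K, fun k => ?_, fun k => ?_, fun k x => ?_,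
    fun k x => ?_, fun x => ?_⟩
  · exact hb.comp (contDiff_const_smul _)
  · exact b.hasCompactSupport.comp_smul (hpos k).ne'
  · rw [abs_of_nonneg b.nonneg]
    exact b.le_one
  · have hd : fderiv ℝ (fun x => b ((1 / ((k : ℝ) + 1)) • x)) x = _ := ((hb.differentiable (by simp) _).hasFDerivAt.comp x
      ((hasFDerivAt_id x).const_smul (1 / ((k : ℝ) + 1)))).fderiv
    rw [hd, ContinuousLinearMap.comp_smul, norm_smul, Real.norm_of_nonneg (hpos k).le, mul_comm]
    exact mul_le_mul_of_nonneg_right (hK _) (hpos k).le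
  · have h0 : b (0 : En n) = 1 := b.one_of_mem_closedBall (by simp [b])
    have hx : Tendsto (fun k : ℕ => (1 / ((k : ℝ) + 1)) • x) atTop (𝓝 0) := by
      simpa using (tendsto_one_div_add_atTop_nhds_zero_nat (𝕜 := ℝ)).smul_const x
    simpa only [h0, Function.comp_def] using (b.continuous.tendsto 0).comp hx

lemma integral_perturb {μ : Measure (En n)} {F : En n → ℝ} (hF : Continuous F)
    (g : En n → ℝ) :
    ∫ x, g x ∂(perturb μ F) =
      (∫ x, Real.exp (-F x) ∂μ)⁻¹ * ∫ x, Real.exp (-F x) * g x ∂μ := by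
  rw [perturb, integral_smul_measure, integral_withDensity_exp_neg hF, ENNReal.toReal_inv,
    ENNReal.toReal_ofReal (integral_nonneg fun x => (Real.exp_pos _).le), smul_eq_mul]

lemma integral_sq_mul_exp_le
    {μ : Measure (En n)} [IsProbabilityMeasure μ] {V F f : En n → ℝ} (hV : ContDiff ℝ 1 V)
    (hμ : μ = volume.withDensity fun x => ENNReal.ofReal (Real.exp (-V x)))
    (hF : ContDiff ℝ 2 F) (hFint : Integrable (fun x => Real.exp (-F x)) μ)
    (hFint' : Integrable (fun x => Real.exp (-F x / 2)) μ)
    {C ε : ℝ} (hP : PoincareLE μ C) (hC : 0 ≤ C)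
    (hcond : ∀ x, C * max (genA V F x - (1 / 2) * ‖gradient F x‖ ^ 2) 0 ≤ 2 * (1 - ε))
    (hf : ContDiff ℝ 1 f) {M L : ℝ} (hM : ∀ x, |f x| ≤ M) (hL : ∀ x, ‖fderiv ℝ f x‖ ≤ L) :
    ε * (∫ x, Real.exp (-F x) * (f x) ^ 2 ∂μ) ≤
      C * (∫ x, Real.exp (-F x) * ‖gradient f x‖ ^ 2 ∂μ)
        + (∫ x, f x * Real.exp (-F x / 2) ∂μ) ^ 2 := by
  obtain ⟨χ, K, hχ, hχc, hχ1, hχK, hχlim⟩ := exists_cutoff_seq n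
  have hM0 : 0 ≤ M := (abs_nonneg _).trans (hM 0)
  have hK0 : 0 ≤ K := by simpa using (norm_nonneg _).trans (hχK 0 0)
  have hχ' k : ContDiff ℝ 1 (χ k) := (hχ k).of_le (by exact_mod_cast le_top)
  have hFc := hF.continuous
  have hfc := hf.continuous
  have hh k : ContDiff ℝ 1 fun x => χ k x * f x := (hχ' k).mul hf
  have hhc k : Continuous fun x => χ k x * f x := (hh k).continuous
  have hhc' k : Continuous (fderiv ℝ fun x => χ k x * f x) :=
    (hh k).continuous_fderiv one_ne_zero
  have hfd k x : fderiv ℝ (fun x => χ k x * f x) x =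
      χ k x • fderiv ℝ f x + f x • fderiv ℝ (χ k) x :=
    fderiv_fun_mul ((hχ' k).differentiable one_ne_zero x) (hf.differentiable one_ne_zero x)
  have hb k x : |χ k x * f x| ≤ M := by
    rw [abs_mul]
    calc |χ k x| * |f x| ≤ 1 * M := mul_le_mul (hχ1 k x) (hM x) (abs_nonneg _) zero_le_one
      _ = M := one_mul M
  have hb' k x : ‖fderiv ℝ (fun x => χ k x * f x) x‖ ≤ L + M * K := by
    rw [hfd]
    have h1 : (1 : ℝ) / ((k : ℝ) + 1) ≤ 1 := by
      rw [div_le_one (by positivity)]; linarith [k.cast_nonneg (α := ℝ)]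
    calc _ ≤ |χ k x| * ‖fderiv ℝ f x‖ + |f x| * ‖fderiv ℝ (χ k) x‖ := by
          simpa only [norm_smul, Real.norm_eq_abs] using
            norm_add_le (χ k x • fderiv ℝ f x) (f x • fderiv ℝ (χ k) x)
      _ ≤ 1 * L + M * K := by
          gcongr
          · exact hχ1 k x
          · exact hL x
          · exact hM x
          · exact (hχK k x).trans (mul_le_of_le_one_right hK0 h1)
      _ = L + M * K := by ring
  have hl x : Tendsto (fun k => χ k x * f x) atTop (𝓝 (f x)) := by
    simpa using (hχlim x).mul_const (f x)
  have hl' x : Tendsto (fun k => fderiv ℝ (fun x => χ k x * f x) x) atTop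
      (𝓝 (fderiv ℝ f x)) := by
    have h0 : Tendsto (fun k => fderiv ℝ (χ k) x) atTop (𝓝 0) :=
      squeeze_zero_norm (fun k => hχK k x) (by
        simpa using (tendsto_one_div_add_atTop_nhds_zero_nat (𝕜 := ℝ)).const_mul K)
    simp only [hfd]
    simpa using ((hχlim x).smul_const (fderiv ℝ f x)).add (h0.const_smul (f x))
  simp only [norm_gradient_eq_norm_fderiv]
  refine le_of_tendsto_of_tendsto' (Tendsto.const_mul ε
    (tendsto_integral_of_dominated_convergence
      (F := fun k x => Real.exp (-F x) * (χ k x * f x) ^ 2)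
      (fun x => Real.exp (-F x) * M ^ 2)
      (fun k => ?_) (hFint.mul_const _) ?_ ?_))
    ((Tendsto.const_mul C
      (tendsto_integral_of_dominated_convergence
        (F := fun k x => Real.exp (-F x) * ‖fderiv ℝ (fun x => χ k x * f x) x‖ ^ 2)
        (fun x => Real.exp (-F x) * (L + M * K) ^ 2)
        (fun k => ?_) (hFint.mul_const _) ?_ ?_)).add
    (Tendsto.pow (tendsto_integral_of_dominated_convergence
      (F := fun k x => χ k x * f x * Real.exp (-F x / 2))
      (fun x => M * Real.exp (-F x / 2))
      (fun k => ?_) (hFint'.const_mul _) ?_ ?_) 2))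
    (fun k => by
      simpa only [norm_gradient_eq_norm_fderiv] using
        integral_sq_mul_exp_le_of_hasCompactSupport hV hμ hF hP hC hcond (hh k)
          (hχc k).mul_right)
  · have := hhc k
    exact (by fun_prop : Continuous _).aestronglyMeasurable
  · refine fun k => ae_of_all _ fun x => ?_
    rw [norm_mul, norm_pow, Real.norm_of_nonneg (Real.exp_pos _).le]
    gcongr
    exact hb k x
  · exact ae_of_all _ fun x => ((hl x).pow 2).const_mul _
  · have := hhc' k
    exact (by fun_prop : Continuous _).aestronglyMeasurable
  · refine fun k => ae_of_all _ fun x => ?_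
    rw [norm_mul, norm_pow, norm_norm, Real.norm_of_nonneg (Real.exp_pos _).le]
    gcongr
    exact hb' k x
  · exact ae_of_all _ fun x => ((hl' x).norm.pow 2).const_mul _
  · have := hhc k
    exact (by fun_prop : Continuous _).aestronglyMeasurable
  · refine fun k => ae_of_all _ fun x => ?_
    rw [norm_mul, Real.norm_of_nonneg (Real.exp_pos (-F x / 2)).le]
    gcongr
    exact hb k x
  · exact ae_of_all _ fun x => (hl x).mul_const _

end PoincarePerturbation

/-- If `V` is `C¹`, `F` is `C²` and
`C_P(μ) · sup_x (AF - |∇F|²/2)₊ ≤ 2(1-ε)` for some `ε > 0`, where `A = Δ - ∇V·∇`,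
then `C_P(μ_F) ≤ C_P(μ)/ε`. -/
theorem poincare_of_generator_perturbation
    {n : ℕ} (μ : Measure (En n)) [IsProbabilityMeasure μ] (V : En n → ℝ)
    (hV : ContDiff ℝ 1 V)
    (hμ : μ = volume.withDensity fun x => ENNReal.ofReal (Real.exp (-V x)))
    (F : En n → ℝ) (hF : ContDiff ℝ 2 F)
    (hFint : Integrable (fun x => Real.exp (-F x)) μ)
    (hFpos : 0 < ∫ x, Real.exp (-F x) ∂μ)
    (Cμ : ℝ) (hCμ : 0 ≤ Cμ) (hP : PoincareLE μ Cμ)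
    (ε : ℝ) (hε : 0 < ε)
    (hcond : ∀ x, Cμ * max (genA V F x - (1 / 2) * ‖gradient F x‖ ^ 2) 0 ≤ 2 * (1 - ε)) :
    PoincareLE (perturb μ F) (Cμ / ε) := by
  rintro f ⟨hf, ⟨M, hM⟩, ⟨L, hL⟩⟩
  have hFc := hF.continuous
  have hfc := hf.continuous
  have hf1 : ContDiff ℝ 1 f := hf.of_le (by exact_mod_cast le_top)
  have hFint' : Integrable (fun x => Real.exp (-F x / 2)) μ := by
    refine ((integrable_const (1 : ℝ)).add hFint).mono'
      (by fun_prop : Continuous _).aestronglyMeasurable (ae_of_all _ fun x => ?_)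
    rw [Real.norm_of_nonneg (Real.exp_pos _).le]
    have h2 : Real.exp (-F x) = Real.exp (-F x / 2) ^ 2 := by
      rw [← Real.exp_nat_mul]; congr 1; push_cast; ring
    simp only [Pi.add_apply]
    rw [h2]
    nlinarith [sq_nonneg (Real.exp (-F x / 2) - 1 / 2)]
  have hpos' : 0 < ∫ x, Real.exp (-F x / 2) ∂μ := integral_exp_pos hFint'
  have hif' : Integrable (fun x => f x * Real.exp (-F x / 2)) μ :=
    hFint'.bdd_mul hfc.aestronglyMeasurable (ae_of_all _ hM)
  have hif : Integrable (fun x => Real.exp (-F x) * f x) μ :=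
    hFint.mul_bdd hfc.aestronglyMeasurable (ae_of_all _ hM)
  have hif2 : Integrable (fun x => Real.exp (-F x) * (f x) ^ 2) μ :=
    hFint.mul_bdd (c := M ^ 2) (hfc.pow 2).aestronglyMeasurable (ae_of_all _ fun x => by
      rw [norm_pow]
      exact pow_le_pow_left₀ (norm_nonneg _) (hM x) 2)
  set Z := ∫ x, Real.exp (-F x) ∂μ with hZ
  set c := (∫ x, f x * Real.exp (-F x / 2) ∂μ) / ∫ x, Real.exp (-F x / 2) ∂μ with hc
  have hzero : ∫ x, (f x - c) * Real.exp (-F x / 2) ∂μ = 0 := by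
    simp only [sub_mul]
    rw [integral_sub hif' (hFint'.const_mul c), integral_const_mul, hc,
      div_mul_cancel₀ _ hpos'.ne', sub_self]
  have hgrad x : gradient (fun x => f x - c) x = gradient f x := by
    simp only [gradient, fderiv_sub_const]
  have key := integral_sq_mul_exp_le hV hμ hF hFint hFint' hP hCμ hcond
    (f := fun x => f x - c) (hf1.sub contDiff_const) (M := M + |c|) (L := L)
    (fun x => (abs_sub _ _).trans (by linarith [hM x]))
    (fun x => by
      rw [fderiv_sub_const]
      exact norm_fderiv_le_of_lipschitz ℝ hL)
  simp only [hgrad, hzero] at key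
  have hexp : ∫ x, Real.exp (-F x) * (f x - c) ^ 2 ∂μ =
      (∫ x, Real.exp (-F x) * (f x) ^ 2 ∂μ) - 2 * c * (∫ x, Real.exp (-F x) * f x ∂μ)
        + c ^ 2 * Z := by
    have h (x : En n) : Real.exp (-F x) * (f x - c) ^ 2 =
        Real.exp (-F x) * (f x) ^ 2 - 2 * c * (Real.exp (-F x) * f x)
          + c ^ 2 * Real.exp (-F x) := by ring
    simp only [h]
    rw [integral_add (by exact hif2.sub (hif.const_mul _)) (hFint.const_mul _),
      integral_sub hif2 (hif.const_mul _), integral_const_mul, integral_const_mul]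
  rw [hexp] at key
  rw [integral_perturb hFc, integral_perturb hFc, integral_perturb hFc, ← hZ]
  set A := ∫ x, Real.exp (-F x) * (f x) ^ 2 ∂μ
  set B := ∫ x, Real.exp (-F x) * f x ∂μ
  set G := ∫ x, Real.exp (-F x) * ‖gradient f x‖ ^ 2 ∂μ
  have hvar : Z⁻¹ * A - (Z⁻¹ * B) ^ 2 ≤ Z⁻¹ * (A - 2 * c * B + c ^ 2 * Z) := by
    have : Z⁻¹ * (A - 2 * c * B + c ^ 2 * Z) - (Z⁻¹ * A - (Z⁻¹ * B) ^ 2) = (Z⁻¹ * B - c) ^ 2 := by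
      field_simp
      ring
    linarith [sq_nonneg (Z⁻¹ * B - c)]
  refine hvar.trans ?_
  have hle : A - 2 * c * B + c ^ 2 * Z ≤ Cμ / ε * G := by
    rw [div_mul_eq_mul_div, le_div_iff₀ hε]
    linarith
  calc _ ≤ Z⁻¹ * (Cμ / ε * G) := mul_le_mul_of_nonneg_left hle (inv_nonneg.2 hFpos.le)
    _ = _ := by ring
end

section
/- Assume F is L-Lipschitz on the support of μ, μ(e^{-F}) = 1, and C_{LS}(μ) < ∞. Then for all β > 0 and all θ > 0, C_{LS}(μ_F) ≤ ((β+1)(1+θ⁻¹)/β) C_{LS}(μ) + C_P(μ_F)(2 + μ(F)) + L² C_P(μ_F) C_{LS}(μ) · ( (1+θ)(1+β)/(4β) + β²/2 ). -/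
open MeasureTheory Real Set
open scoped ENNReal RealInnerProductSpace Pointwise Matrix

/-- A function on `[0, ∞)` vanishing to first order at `0` with nonnegative second derivative
is nonnegative. -/
lemma nonneg_of_second_deriv_nonneg {p p' p'' : ℝ → ℝ}
    (h : ∀ t, HasDerivAt p (p' t) t) (h' : ∀ t, HasDerivAt p' (p'' t) t)
    (h0 : p 0 = 0) (h0' : p' 0 = 0) (hnn : ∀ t, 0 ≤ p'' t) {t : ℝ} (ht : 0 ≤ t) : 0 ≤ p t := by
  have m' : Monotone p' := monotone_of_deriv_nonneg (fun t => (h' t).differentiableAt)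
    (fun t => by rw [(h' t).deriv]; exact hnn t)
  have m : MonotoneOn p (Ici 0) := by
    refine monotoneOn_of_deriv_nonneg (convex_Ici 0)
      (fun t _ => (h t).continuousAt.continuousWithinAt)
      (fun t _ => (h t).differentiableAt.differentiableWithinAt) fun t ht => ?_
    rw [(h t).deriv, ← h0']
    exact m' (interior_subset ht)
  rw [← h0]
  exact m self_mem_Ici ht ht

lemma mul_log_add_le {a b : ℝ} (ha : 0 ≤ a) (hb : 0 < b) :
    a * log b ≤ a * log a + b - a := by
  rcases ha.eq_or_lt with rfl | ha
  · simpa using hb.le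
  · have := Real.log_le_sub_one_of_pos (div_pos hb ha)
    rw [Real.log_div hb.ne' ha.ne'] at this
    have h2 := mul_le_mul_of_nonneg_left this ha.le
    have : a * (b / a - 1) = b - a := by field_simp
    linarith

lemma rothaus_regularized (g : ℝ) {δ t : ℝ} (hδ : 0 < δ) (ht : 0 ≤ t) :
    ((1 + t * g) ^ 2 + δ) * log ((1 + t * g) ^ 2 + δ) ≤
      t ^ 2 * (g ^ 2 * log (g ^ 2)) + (2 * t * arctan t - log (1 + t ^ 2))
      + (2 * t * log (1 + t ^ 2) - 2 * t + 4 * arctan t) * g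
      + ((2 + t ^ 2) * log (1 + t ^ 2) + 2 * t ^ 2 - 2 * t * arctan t) * g ^ 2
      + δ * t ^ 2 + (1 + δ) * log (1 + δ) + 2 * g * t * log (1 + δ) := by
  have hX : ∀ s : ℝ, 0 < (1 + s * g) ^ 2 + δ := fun s => by positivity
  have hT : ∀ s : ℝ, 0 < 1 + s ^ 2 := fun s => by positivity
  have dX : ∀ s : ℝ, HasDerivAt (fun s => (1 + s * g) ^ 2 + δ) (2 * g * (1 + s * g)) s := by
    intro s
    have := ((((hasDerivAt_id s).mul_const g).const_add 1).pow 2).add_const δ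
    exact this.congr_deriv (by simp; ring)
  have dT : ∀ s : ℝ, HasDerivAt (fun s => 1 + s ^ 2) (2 * s) s := by
    intro s
    have := ((hasDerivAt_id s).pow 2).const_add 1
    exact this.congr_deriv (by simp)
  have dLX := fun s => (dX s).log (hX s).ne'
  have dLT := fun s => (dT s).log (hT s).ne'
  have dA := fun s : ℝ => Real.hasDerivAt_arctan s
  have dI := fun s : ℝ => hasDerivAt_id' s
  have key := nonneg_of_second_deriv_nonneg (t := t)
    (p := fun t => t ^ 2 * (g ^ 2 * log (g ^ 2)) + (2 * t * arctan t - log (1 + t ^ 2))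
      + (2 * t * log (1 + t ^ 2) - 2 * t + 4 * arctan t) * g
      + ((2 + t ^ 2) * log (1 + t ^ 2) + 2 * t ^ 2 - 2 * t * arctan t) * g ^ 2
      + δ * t ^ 2 + (1 + δ) * log (1 + δ) + 2 * g * t * log (1 + δ)
      - ((1 + t * g) ^ 2 + δ) * log ((1 + t * g) ^ 2 + δ))
    (p' := fun t => 2 * t * (g ^ 2 * log (g ^ 2)) + 2 * arctan t
      + (2 * log (1 + t ^ 2) + 2) * g
      + (2 * t * log (1 + t ^ 2) + 6 * t - 2 * arctan t) * g ^ 2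
      + 2 * δ * t + 2 * g * log (1 + δ)
      - 2 * g * (1 + t * g) * (log ((1 + t * g) ^ 2 + δ) + 1))
    (p'' := fun t => 2 * (g ^ 2 * log (g ^ 2)) + 2 * (1 / (1 + t ^ 2))
      + 2 * (2 * t / (1 + t ^ 2)) * g
      + (2 * log (1 + t ^ 2) + 2 * t * (2 * t / (1 + t ^ 2)) + 6 - 2 * (1 / (1 + t ^ 2))) * g ^ 2
      + 2 * δ
      - (2 * g * g * (log ((1 + t * g) ^ 2 + δ) + 1)
        + 2 * g * (1 + t * g) * (2 * g * (1 + t * g) / ((1 + t * g) ^ 2 + δ))))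
    ?_ ?_ ?_ ?_ ?_ ht
  · linarith
  · intro s
    have hd := (((((((((dI s).pow 2).mul_const (g ^ 2 * log (g ^ 2))).add
      ((((dI s).const_mul 2).mul (dA s)).sub (dLT s))).add
      ((((((dI s).const_mul 2).mul (dLT s)).sub ((dI s).const_mul 2)).add
        ((dA s).const_mul 4)).mul_const g)).add
      (((((((dI s).pow 2).const_add 2).mul (dLT s)).add (((dI s).pow 2).const_mul 2)).sub
        (((dI s).const_mul 2).mul (dA s))).mul_const (g ^ 2))).add
      (((dI s).pow 2).const_mul δ)).add_const ((1 + δ) * log (1 + δ))).add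
      (((dI s).const_mul (2 * g)).mul_const (log (1 + δ)))).sub ((dX s).mul (dLX s))
    refine hd.congr_deriv ?_
    have h1 := (hT s).ne'
    have h2 := (hX s).ne'
    simp only [Pi.pow_apply, Nat.cast_ofNat, Nat.add_one_sub_one, pow_one]
    field_simp
    ring
  · intro s
    have hd := ((((((((dI s).const_mul 2).mul_const (g ^ 2 * log (g ^ 2))).add
      ((dA s).const_mul 2)).add
      ((((dLT s).const_mul 2).add_const 2).mul_const g)).add
      ((((((dI s).const_mul 2).mul (dLT s)).add ((dI s).const_mul 6)).sub
        ((dA s).const_mul 2)).mul_const (g ^ 2))).add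
      ((dI s).const_mul (2 * δ))).add_const (2 * g * log (1 + δ))).sub
      (((((dI s).mul_const g).const_add 1).const_mul (2 * g)).mul ((dLX s).add_const 1))
    refine hd.congr_deriv ?_
    ring
  · simp
  · simp; ring
  · intro s
    have h1 := hT s
    have h2 := hX s
    have hG := mul_log_add_le (sq_nonneg g) (div_pos h2 h1)
    rw [Real.log_div h2.ne' h1.ne'] at hG
    have hq : 2 * g * (1 + s * g) * (2 * g * (1 + s * g) / ((1 + s * g) ^ 2 + δ)) ≤ 4 * g ^ 2 := by
      rw [mul_div_assoc', div_le_iff₀ h2]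
      nlinarith [mul_nonneg (sq_nonneg g) hδ.le]
    have hid : 2 * (((1 + s * g) ^ 2 + δ) / (1 + s ^ 2)) =
      2 * (1 / (1 + s ^ 2)) + 2 * (2 * s / (1 + s ^ 2)) * g + 2 * (s ^ 2 / (1 + s ^ 2)) * g ^ 2
        + 2 * (δ / (1 + s ^ 2)) := by
      field_simp; ring
    have hone : 1 / (1 + s ^ 2) = 1 - s ^ 2 / (1 + s ^ 2) := by field_simp; ring
    have hss : 2 * s * (2 * s / (1 + s ^ 2)) = 4 * (s ^ 2 / (1 + s ^ 2)) := by ring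
    have hδ' : δ / (1 + s ^ 2) ≤ δ := div_le_self hδ.le (by nlinarith [sq_nonneg s])
    have hsnn : 0 ≤ s ^ 2 / (1 + s ^ 2) * g ^ 2 := by positivity
    have hgg : (1 / (1 + s ^ 2)) * g ^ 2 = g ^ 2 - s ^ 2 / (1 + s ^ 2) * g ^ 2 := by
      rw [hone]; ring
    rw [hss]
    nlinarith

lemma rothaus_pointwise_normalized (g : ℝ) {t : ℝ} (ht : 0 ≤ t) :
    (1 + t * g) ^ 2 * log ((1 + t * g) ^ 2) ≤
      t ^ 2 * (g ^ 2 * log (g ^ 2)) + (2 * t * arctan t - log (1 + t ^ 2))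
      + (2 * t * log (1 + t ^ 2) - 2 * t + 4 * arctan t) * g
      + ((2 + t ^ 2) * log (1 + t ^ 2) + 2 * t ^ 2 - 2 * t * arctan t) * g ^ 2 := by
  have hl : Continuous fun δ : ℝ => ((1 + t * g) ^ 2 + δ) * log ((1 + t * g) ^ 2 + δ) :=
    Real.continuous_mul_log.comp (continuous_const.add continuous_id)
  have hc : ContinuousAt (fun δ : ℝ => log (1 + δ)) 0 :=
    ContinuousAt.log (by fun_prop) (by norm_num)
  have hr : ContinuousAt (fun δ : ℝ =>
      t ^ 2 * (g ^ 2 * log (g ^ 2)) + (2 * t * arctan t - log (1 + t ^ 2))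
      + (2 * t * log (1 + t ^ 2) - 2 * t + 4 * arctan t) * g
      + ((2 + t ^ 2) * log (1 + t ^ 2) + 2 * t ^ 2 - 2 * t * arctan t) * g ^ 2
      + δ * t ^ 2 + (1 + δ) * log (1 + δ) + 2 * g * t * log (1 + δ)) 0 := by
    fun_prop
  have := le_of_tendsto_of_tendsto (hl.continuousAt.tendsto.mono_left nhdsWithin_le_nhds)
    (hr.tendsto.mono_left nhdsWithin_le_nhds)
    (Filter.eventually_of_mem (self_mem_nhdsWithin (s := Ioi (0:ℝ)))
      fun δ hδ => rothaus_regularized g hδ ht)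
  simpa using this

/-- The pointwise inequality whose integrated form is Rothaus' lemma. -/
lemma rothaus_pointwise {a v : ℝ} (ha : a ≠ 0) (hv : 0 < v) :
    ∃ A B D : ℝ, A + D * v = (v + a ^ 2) * log (v + a ^ 2) - v * log v + 2 * v ∧
      ∀ x : ℝ, (a + x) ^ 2 * log ((a + x) ^ 2) ≤ x ^ 2 * log (x ^ 2) + A + B * x + D * x ^ 2 := by
  obtain ⟨t, ht, rfl⟩ : ∃ t, 0 < t ∧ v = a ^ 2 * t ^ 2 :=
    ⟨√(v / a ^ 2), by positivity, by rw [Real.sq_sqrt (by positivity)]; field_simp⟩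
  have ha2 : 0 < a ^ 2 := by positivity
  have ht2 : 0 < t ^ 2 := by positivity
  have hT : 0 < 1 + t ^ 2 := by positivity
  have key : ∀ x : ℝ, (a + x) ^ 2 * log ((a + x) ^ 2) ≤ x ^ 2 * log (x ^ 2)
      + (a ^ 2 * (2 * t * arctan t - log (1 + t ^ 2)) + a ^ 2 * log (a ^ 2))
      + (a * (2 * t * log (1 + t ^ 2) - 2 * t + 4 * arctan t) / t + 2 * a * log (a ^ 2)) * x
      + (((2 + t ^ 2) * log (1 + t ^ 2) + 2 * t ^ 2 - 2 * t * arctan t) / t ^ 2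
        - log (t ^ 2)) * x ^ 2 := by
    intro x
    have h := mul_le_mul_of_nonneg_left
      (rothaus_pointwise_normalized (x / (a * t)) ht.le) ha2.le
    have e1 : 1 + t * (x / (a * t)) = (a + x) / a := by field_simp
    have e2 : a ^ 2 * (((a + x) / a) ^ 2 * log (((a + x) / a) ^ 2))
        = (a + x) ^ 2 * log ((a + x) ^ 2) - (a + x) ^ 2 * log (a ^ 2) := by
      by_cases hx : a + x = 0
      · simp [hx]
      · rw [div_pow, Real.log_div (by positivity) ha2.ne']; field_simp
    have e3 : a ^ 2 * (t ^ 2 * ((x / (a * t)) ^ 2 * log ((x / (a * t)) ^ 2)))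
        = x ^ 2 * log (x ^ 2) - x ^ 2 * log (a ^ 2) - x ^ 2 * log (t ^ 2) := by
      by_cases hx : x = 0
      · simp [hx]
      · rw [div_pow, Real.log_div (by positivity) (by positivity), mul_pow,
          Real.log_mul ha2.ne' ht2.ne']
        field_simp; ring
    rw [e1, e2] at h
    simp only [mul_add, e3] at h
    refine le_of_sub_nonneg ((sub_nonneg.2 h).trans_eq ?_)
    field_simp
    ring
  refine ⟨_, _, _, ?_, key⟩
  rw [show a ^ 2 * t ^ 2 + a ^ 2 = a ^ 2 * (1 + t ^ 2) by ring, Real.log_mul ha2.ne' hT.ne',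
    Real.log_mul ha2.ne' ht2.ne']
  field_simp
  ring

lemma LipschitzWith.exists_contDiff_near {n : ℕ} {T : En n → ℝ} {K : NNReal}
    (hT : LipschitzWith K T) {ε : ℝ} (hε : 0 < ε) :
    ∃ h : En n → ℝ, ContDiff ℝ (⊤ : ℕ∞) h ∧ LipschitzWith K h ∧ ∀ x, |h x - T x| ≤ K * ε := by
  let φ : ContDiffBump (0 : En n) := ⟨ε / 2, ε, by linarith, by linarith⟩
  have hloc : LocallyIntegrable T (volume : Measure (En n)) := hT.continuous.locallyIntegrable
  have hex : ConvolutionExists (φ.normed volume) T (ContinuousLinearMap.lsmul ℝ ℝ) volume :=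
    φ.hasCompactSupport_normed.convolutionExists_left _ φ.continuous_normed hloc
  refine ⟨convolution (φ.normed volume) T (ContinuousLinearMap.lsmul ℝ ℝ) volume,
    φ.hasCompactSupport_normed.contDiff_convolution_left _ φ.contDiff_normed hloc,
    LipschitzWith.of_dist_le_mul fun x y => ?_, fun x => ?_⟩
  · rw [Real.dist_eq, convolution_def, convolution_def,
      ← integral_sub (hex x).integrable (hex y).integrable]
    rw [← Real.norm_eq_abs]
    refine (norm_integral_le_integral_norm _).trans ?_
    calc
      _ ≤ ∫ t, φ.normed volume t * (K * dist x y) := by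
        refine integral_mono_of_nonneg (Filter.Eventually.of_forall fun t => norm_nonneg _)
          (φ.integrable_normed.mul_const _) (Filter.Eventually.of_forall fun t => ?_)
        simp only [ContinuousLinearMap.lsmul_apply, smul_eq_mul, ← mul_sub, norm_mul]
        rw [Real.norm_of_nonneg (φ.nonneg_normed t)]
        refine mul_le_mul_of_nonneg_left ?_ (φ.nonneg_normed t)
        simpa [Real.dist_eq] using hT.dist_le_mul (x - t) (y - t)
      _ = K * dist x y := by rw [integral_mul_const, φ.integral_normed, one_mul]
  · rw [← Real.dist_eq]
    refine φ.dist_normed_convolution_le hT.continuous.aestronglyMeasurable fun y hy => ?_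
    exact (hT.dist_le_mul y x).trans
      (mul_le_mul_of_nonneg_left (Metric.mem_ball.1 hy).le K.coe_nonneg)

/-- A Lipschitz function is a pointwise limit of test functions with the same Lipschitz constant,
dominated by the function itself up to a constant. -/
lemma LipschitzWith.exists_testFun_tendsto {n : ℕ} {G : En n → ℝ} {K : NNReal}
    (hG : LipschitzWith K G) :
    ∃ h : ℕ → En n → ℝ, (∀ k, IsTestFun (h k)) ∧ (∀ k x, ‖fderiv ℝ (h k) x‖ ≤ K) ∧
      (∀ k x, |h k x| ≤ |G x| + K) ∧
      ∀ x, Filter.Tendsto (fun k => h k x) Filter.atTop (nhds (G x)) := by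
  have hT : ∀ k : ℕ, LipschitzWith K fun x => max (min (G x) k) (-k) := fun k =>
    (hG.min_const _).max_const _
  choose h hsm hlip happ using fun k : ℕ =>
    (hT k).exists_contDiff_near (ε := 1 / ((k : ℝ) + 1)) (by positivity)
  have hk1 : ∀ k : ℕ, 1 / ((k : ℝ) + 1) ≤ 1 := fun k => by
    rw [div_le_one (by positivity)]; linarith [Nat.cast_nonneg (α := ℝ) k]
  have hKk : ∀ k : ℕ, (K : ℝ) * (1 / ((k : ℝ) + 1)) ≤ K := fun k =>
    mul_le_of_le_one_right K.coe_nonneg (hk1 k)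
  have hTk : ∀ (k : ℕ) x, |max (min (G x) (k : ℝ)) (-k)| ≤ k := fun k x => by
    have := Nat.cast_nonneg (α := ℝ) k
    exact abs_le.2 ⟨le_max_right _ _, max_le (min_le_right _ _) (by linarith)⟩
  have hTG : ∀ (k : ℕ) x, |max (min (G x) (k : ℝ)) (-k)| ≤ |G x| := fun k x => by
    have := Nat.cast_nonneg (α := ℝ) k
    refine abs_le.2 ⟨le_max_of_le_left (le_min (neg_abs_le _) ?_), max_le
      ((min_le_left _ _).trans (le_abs_self _)) ?_⟩ <;> linarith [abs_nonneg (G x)]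
  have hh : ∀ k x, |h k x| ≤ |max (min (G x) (k : ℝ)) (-k)| + K := fun k x => by
    have := abs_sub_abs_le_abs_sub (h k x) (max (min (G x) (k : ℝ)) (-k))
    linarith [happ k x, hKk k]
  refine ⟨h, fun k => ⟨hsm k, ⟨k + K, fun x => ?_⟩, K, hlip k⟩,
    fun k x => norm_fderiv_le_of_lipschitz ℝ (hlip k), fun k x => ?_, fun x => ?_⟩
  · linarith [hh k x, hTk k x]
  · linarith [hh k x, hTG k x]
  · have h1 : Filter.Tendsto (fun k => h k x - max (min (G x) (k : ℝ)) (-k)) Filter.atTop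
        (nhds 0) := by
      refine squeeze_zero_norm (fun k => happ k x) ?_
      simpa using (tendsto_one_div_add_atTop_nhds_zero_nat (𝕜 := ℝ)).const_mul (K : ℝ)
    have h2 : Filter.Tendsto (fun k : ℕ => max (min (G x) (k : ℝ)) (-k)) Filter.atTop
        (nhds (G x)) := by
      refine tendsto_const_nhds.congr' ?_
      filter_upwards [Filter.eventually_ge_atTop ⌈|G x|⌉₊] with k hk
      have hk' : |G x| ≤ k := Nat.ceil_le.1 hk
      rw [min_eq_left ((le_abs_self _).trans hk'),
        max_eq_left (by linarith [neg_abs_le (G x)])]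
    simpa using h1.add h2

lemma norm_gradient_eq {n : ℕ} (f : En n → ℝ) (x : En n) : ‖gradient f x‖ = ‖fderiv ℝ f x‖ := by
  simp [gradient]

namespace IsTestFun

variable {n : ℕ} {f h : En n → ℝ}

lemma of_fderiv_bound (hs : ContDiff ℝ (⊤ : ℕ∞) f) {M B : ℝ} (hM : ∀ x, |f x| ≤ M)
    (hB : ∀ x, ‖fderiv ℝ f x‖ ≤ B) : IsTestFun f :=
  ⟨hs, ⟨M, hM⟩, B.toNNReal, lipschitzWith_of_nnnorm_fderiv_le
    (hs.differentiable (by simp)) fun x => by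
      rw [← NNReal.coe_le_coe]; exact (hB x).trans (Real.le_coe_toNNReal B)⟩

lemma differentiable (hf : IsTestFun f) : Differentiable ℝ f := hf.1.differentiable (by simp)

lemma continuous (hf : IsTestFun f) : Continuous f := hf.1.continuous

lemma exists_fderiv_bound (hf : IsTestFun f) : ∃ B, ∀ x, ‖fderiv ℝ f x‖ ≤ B :=
  let ⟨K, hK⟩ := hf.2.2
  ⟨K, fun _ => norm_fderiv_le_of_lipschitz ℝ hK⟩

lemma continuous_norm_fderiv (hf : IsTestFun f) : Continuous fun x => ‖fderiv ℝ f x‖ :=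
  (hf.1.continuous_fderiv (by simp)).norm

lemma const (c : ℝ) : IsTestFun fun _ : En n => c :=
  ⟨contDiff_const, ⟨|c|, fun _ => le_rfl⟩, 0, LipschitzWith.const c⟩

lemma sub_const (hf : IsTestFun f) (c : ℝ) : IsTestFun fun x => f x - c := by
  obtain ⟨M, hM⟩ := hf.2.1
  obtain ⟨B, hB⟩ := hf.exists_fderiv_bound
  refine of_fderiv_bound (hf.1.sub contDiff_const) (M := M + |c|) (B := B)
    (fun x => (abs_sub _ _).trans (by linarith [hM x])) fun x => ?_
  rw [fderiv_sub_const]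
  exact hB x

lemma fderiv_mul_exp (hf : IsTestFun f) (hh : IsTestFun h) (c : ℝ) (x : En n) :
    fderiv ℝ (fun y => f y * exp (c * h y)) x
      = exp (c * h x) • (fderiv ℝ f x + (c * f x) • fderiv ℝ h x) := by
  have h1 := (hf.differentiable x).hasFDerivAt
  have h2 := ((hh.differentiable x).hasFDerivAt.const_mul c).exp
  rw [(h1.fun_mul h2).fderiv]
  ext v
  simp
  ring

lemma mul_exp (hf : IsTestFun f) (hh : IsTestFun h) (c : ℝ) :
    IsTestFun fun x => f x * exp (c * h x) := by
  obtain ⟨M, hM⟩ := hf.2.1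
  obtain ⟨N, hN⟩ := hh.2.1
  obtain ⟨A, hA⟩ := hf.exists_fderiv_bound
  obtain ⟨B, hB⟩ := hh.exists_fderiv_bound
  have hE : ∀ x, exp (c * h x) ≤ exp (|c| * N) := fun x => by
    refine exp_le_exp.2 ((le_abs_self _).trans ?_)
    rw [abs_mul]
    exact mul_le_mul_of_nonneg_left (hN x) (abs_nonneg c)
  have hM0 : 0 ≤ M := (abs_nonneg _).trans (hM 0)
  refine of_fderiv_bound (hf.1.mul (contDiff_const.mul hh.1).exp)
    (M := M * exp (|c| * N)) (B := exp (|c| * N) * (A + |c| * M * B)) (fun x => ?_) fun x => ?_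
  · rw [abs_mul, abs_of_pos (exp_pos _)]
    exact mul_le_mul (hM x) (hE x) (exp_pos _).le hM0
  · rw [hf.fderiv_mul_exp hh, norm_smul, Real.norm_of_nonneg (exp_pos _).le]
    refine mul_le_mul (hE x) ((norm_add_le _ _).trans (add_le_add (hA x) ?_)) (norm_nonneg _)
      (exp_pos _).le
    rw [norm_smul, norm_mul, Real.norm_eq_abs, Real.norm_eq_abs]
    exact mul_le_mul (mul_le_mul_of_nonneg_left (hM x) (abs_nonneg _)) (hB x) (norm_nonneg _)
      (by positivity)

end IsTestFun

/-- A continuous bounded function is integrable for a finite measure. -/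
lemma integrable_of_continuous_of_abs_le {n : ℕ} (μ : Measure (En n)) [IsFiniteMeasure μ]
    {f : En n → ℝ} (hf : Continuous f) {M : ℝ} (hM : ∀ x, |f x| ≤ M) : Integrable f μ :=
  Integrable.of_bound hf.aestronglyMeasurable M (Filter.Eventually.of_forall hM)

open ProbabilityTheory in
/-- Herbst's argument for test functions. -/
lemma LogSobolevLE.integral_exp_le_of_testFun {n : ℕ} {μ : Measure (En n)} [IsProbabilityMeasure μ]
    {C : ℝ} (hC : 0 ≤ C) (hLS : LogSobolevLE μ C) {h : En n → ℝ} (hh : IsTestFun h) {L : ℝ}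
    (hL : ∀ x, ‖fderiv ℝ h x‖ ≤ L) {r : ℝ} (hr : 0 < r) :
    ∫ x, exp (r * h x) ∂μ ≤ exp (r * ∫ x, h x ∂μ + r ^ 2 * L ^ 2 * C / 4) := by
  obtain ⟨N, hN⟩ := hh.2.1
  have hE : ∀ s x, exp (s * h x) ≤ exp (|s| * N) := fun s x => by
    refine exp_le_exp.2 ((le_abs_self _).trans ?_)
    rw [abs_mul]
    exact mul_le_mul_of_nonneg_left (hN x) (abs_nonneg s)
  have hint : ∀ s, Integrable (fun x => exp (s * h x)) μ := fun s =>
    integrable_of_continuous_of_abs_le μ (by have := hh.continuous; fun_prop)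
      fun x => (abs_of_pos (exp_pos _)).trans_le (hE s x)
  have hset : ∀ s, s ∈ interior (integrableExpSet h μ) := fun s => by
    have : integrableExpSet h μ = univ := eq_univ_of_forall hint
    simp [this]
  have hd : ∀ s, HasDerivAt (cgf h μ) (deriv (cgf h μ) s) s := fun s =>
    (analyticAt_cgf (hset s)).differentiableAt.hasDerivAt
  set c := L ^ 2 * C / 4 with hc
  have hineq : ∀ s, 0 < s → s * deriv (cgf h μ) s - cgf h μ s ≤ c * s ^ 2 := by
    intro s hs
    have hM : 0 < mgf h μ s := mgf_pos (hint s)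
    have key := hLS _ ((IsTestFun.const 1).mul_exp hh (s / 2))
    have e1 : ∀ x, (1 * exp (s / 2 * h x)) ^ 2 = exp (s * h x) := fun x => by
      rw [one_mul, ← Real.exp_nat_mul]; congr 1; push_cast; ring
    have e2 : ∀ x, ‖gradient (fun y => 1 * exp (s / 2 * h y)) x‖ ^ 2
        ≤ s ^ 2 / 4 * L ^ 2 * exp (s * h x) := fun x => by
      rw [norm_gradient_eq, (IsTestFun.const 1).fderiv_mul_exp hh, norm_smul, mul_pow,
        Real.norm_of_nonneg (exp_pos _).le]
      simp only [fderiv_fun_const, Pi.zero_apply, zero_add, norm_smul, mul_one, mul_pow]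
      rw [← one_mul (exp (s / 2 * h x)), e1, Real.norm_eq_abs, sq_abs, mul_comm]
      have : (s / 2) ^ 2 * ‖fderiv ℝ h x‖ ^ 2 ≤ s ^ 2 / 4 * L ^ 2 := by
        rw [div_pow]; norm_num; gcongr; exact hL x
      exact mul_le_mul_of_nonneg_right this (exp_pos _).le
    simp only [e1, Real.log_exp] at key
    have hgrad : ∫ x, ‖gradient (fun y => 1 * exp (s / 2 * h y)) x‖ ^ 2 ∂μ
        ≤ s ^ 2 / 4 * L ^ 2 * mgf h μ s := by
      rw [mgf, ← integral_const_mul]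
      exact integral_mono_of_nonneg (Filter.Eventually.of_forall fun x => by positivity)
        ((hint s).const_mul _) (Filter.Eventually.of_forall e2)
    have e3 : ∫ x, exp (s * h x) * (s * h x) ∂μ = s * (deriv (cgf h μ) s * mgf h μ s) := by
      rw [deriv_cgf (hset s), div_mul_cancel₀ _ hM.ne', ← integral_const_mul]
      congr 1 with x
      ring
    have hk := key.trans (mul_le_mul_of_nonneg_left hgrad hC)
    rw [e3] at hk
    change _ - mgf h μ s * cgf h μ s ≤ _ at hk
    rw [← mul_le_mul_iff_left₀ hM]
    rw [hc]
    linarith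
  have hanti : AntitoneOn (fun s => cgf h μ s / s - c * s) (Ioi 0) := by
    have hd' : ∀ s ∈ Ioi (0 : ℝ), HasDerivAt (fun s => cgf h μ s / s - c * s)
        ((deriv (cgf h μ) s * s - cgf h μ s * 1) / s ^ 2 - c * 1) s := fun s hs =>
      ((hd s).div (hasDerivAt_id' s) (ne_of_gt hs)).sub ((hasDerivAt_id' s).const_mul c)
    refine antitoneOn_of_deriv_nonpos (convex_Ioi 0)
      (fun s hs => (hd' s hs).continuousAt.continuousWithinAt)
      (fun s hs => (hd' s (interior_subset hs)).differentiableAt.differentiableWithinAt)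
      fun s hs => ?_
    have hs0 : 0 < s := interior_subset hs
    rw [(hd' s hs0).deriv, sub_nonpos, div_le_iff₀ (by positivity)]
    linarith [hineq s hs0]
  have hlim : Filter.Tendsto (fun s => cgf h μ s / s - c * s) (nhdsWithin 0 (Ioi 0))
      (nhds (∫ x, h x ∂μ)) := by
    have h1 := (hasDerivAt_iff_tendsto_slope_zero.1 (hd 0)).mono_left
      (nhdsWithin_mono _ fun s (hs : 0 < s) => hs.ne')
    have h2 : Filter.Tendsto (fun s : ℝ => c * s) (nhdsWithin 0 (Ioi 0)) (nhds (c * 0)) :=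
      ((continuous_const.mul continuous_id).tendsto 0).mono_left nhdsWithin_le_nhds
    have h3 := h1.sub h2
    rw [deriv_cgf_zero (hset 0)] at h3
    simp only [zero_add, cgf_zero, sub_zero, smul_eq_mul, probReal_univ, div_one,
      mul_zero] at h3
    refine h3.congr fun s => ?_
    ring
  have hfin : cgf h μ r / r - c * r ≤ ∫ x, h x ∂μ := by
    refine ge_of_tendsto hlim ?_
    filter_upwards [Ioo_mem_nhdsGT hr] with s hs
    exact hanti hs.1 hr hs.2.le
  have hM : 0 < mgf h μ r := mgf_pos (hint r)
  change mgf h μ r ≤ _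
  rw [← Real.log_le_iff_le_exp hM]
  change cgf h μ r ≤ _
  rw [sub_le_iff_le_add, div_le_iff₀ hr] at hfin
  rw [hc] at hfin
  linarith

/-- Herbst's argument for Lipschitz functions. -/
lemma LogSobolevLE.integral_exp_le_of_lipschitz {n : ℕ} {μ : Measure (En n)}
    [IsProbabilityMeasure μ] {C : ℝ} (hC : 0 ≤ C) (hLS : LogSobolevLE μ C) {G : En n → ℝ}
    {K : NNReal} (hG : LipschitzWith K G) (hGi : Integrable G μ) {r : ℝ} (hr : 0 < r) :
    Integrable (fun x => exp (r * G x)) μ ∧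
      ∫ x, exp (r * G x) ∂μ ≤ exp (r * ∫ x, G x ∂μ + r ^ 2 * (K : ℝ) ^ 2 * C / 4) := by
  obtain ⟨h, hh, hK, hdom, hlim⟩ := hG.exists_testFun_tendsto
  have hmean : Filter.Tendsto (fun k => ∫ x, h k x ∂μ) Filter.atTop (nhds (∫ x, G x ∂μ)) :=
    tendsto_integral_of_dominated_convergence (fun x => |G x| + K)
      (fun k => (hh k).continuous.aestronglyMeasurable) (hGi.abs.add (integrable_const _))
      (fun k => Filter.Eventually.of_forall (hdom k)) (Filter.Eventually.of_forall hlim)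
  have hcont : ∀ k, Continuous fun x => exp (r * h k x) := fun k => by
    have := (hh k).continuous
    fun_prop
  have hbound : ∫⁻ x, ENNReal.ofReal (exp (r * G x)) ∂μ
      ≤ ENNReal.ofReal (exp (r * ∫ x, G x ∂μ + r ^ 2 * (K : ℝ) ^ 2 * C / 4)) := by
    have hpt : ∀ x, Filter.Tendsto (fun k => ENNReal.ofReal (exp (r * h k x))) Filter.atTop
        (nhds (ENNReal.ofReal (exp (r * G x)))) := fun x =>
      ENNReal.tendsto_ofReal (((hlim x).const_mul r).rexp)
    calc ∫⁻ x, ENNReal.ofReal (exp (r * G x)) ∂μ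
        = ∫⁻ x, Filter.liminf (fun k => ENNReal.ofReal (exp (r * h k x))) Filter.atTop ∂μ := by
          congr 1 with x; exact (hpt x).liminf_eq.symm
      _ ≤ Filter.liminf (fun k => ∫⁻ x, ENNReal.ofReal (exp (r * h k x)) ∂μ) Filter.atTop :=
          lintegral_liminf_le fun k => (hcont k).measurable.ennreal_ofReal
      _ ≤ Filter.liminf (fun k => ENNReal.ofReal
            (exp (r * ∫ x, h k x ∂μ + r ^ 2 * (K : ℝ) ^ 2 * C / 4))) Filter.atTop := by
          refine Filter.liminf_le_liminf (Filter.Eventually.of_forall fun k => ?_)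
          obtain ⟨M, hM⟩ := ((IsTestFun.const 1).mul_exp (hh k) r).2.1
          rw [← ofReal_integral_eq_lintegral_ofReal (integrable_of_continuous_of_abs_le μ (hcont k)
            fun x => by simpa using hM x) (Filter.Eventually.of_forall fun x => (exp_pos _).le)]
          exact ENNReal.ofReal_le_ofReal (hLS.integral_exp_le_of_testFun hC (hh k) (hK k) hr)
      _ = _ := Filter.Tendsto.liminf_eq
          (ENNReal.tendsto_ofReal (((hmean.const_mul r).add_const _).rexp))
  have hcG : Continuous fun x => exp (r * G x) := by
    have := hG.continuous
    fun_prop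
  have hi : Integrable (fun x => exp (r * G x)) μ := by
    refine ⟨hcG.aestronglyMeasurable, ?_⟩
    rw [hasFiniteIntegral_iff_ofReal (Filter.Eventually.of_forall fun x => (exp_pos _).le)]
    exact hbound.trans_lt ENNReal.ofReal_lt_top
  refine ⟨hi, ?_⟩
  rw [← ENNReal.ofReal_le_ofReal_iff (exp_pos _).le, ofReal_integral_eq_lintegral_ofReal hi
    (Filter.Eventually.of_forall fun x => (exp_pos _).le)]
  exact hbound

lemma LogSobolevLE.integrable_exp_abs {n : ℕ} {μ : Measure (En n)}
    [IsProbabilityMeasure μ] {C : ℝ} (hC : 0 ≤ C) (hLS : LogSobolevLE μ C) {G : En n → ℝ}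
    {K : NNReal} (hG : LipschitzWith K G) (hGi : Integrable G μ) {r : ℝ} (hr : 0 < r) :
    Integrable (fun x => exp (r * |G x|)) μ := by
  have h1 := (hLS.integral_exp_le_of_lipschitz hC hG hGi hr).1
  have h2 := (hLS.integral_exp_le_of_lipschitz hC hG.neg hGi.neg hr).1
  refine (h1.add h2).mono' ?_ (Filter.Eventually.of_forall fun x => ?_)
  · have := hG.continuous
    exact Continuous.aestronglyMeasurable (by fun_prop)
  · rw [Real.norm_of_nonneg (exp_pos _).le]
    rcases abs_cases (G x) with ⟨h, -⟩ | ⟨h, -⟩ <;> rw [h] <;>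
      simp [(exp_pos _).le]

lemma integrable_comp_of_continuous_of_abs_le {n : ℕ} (μ : Measure (En n)) [IsFiniteMeasure μ]
    {w : En n → ℝ} (hw : Continuous w) {M : ℝ} (hM : ∀ x, |w x| ≤ M) {φ : ℝ → ℝ}
    (hφ : Continuous φ) : Integrable (fun x => φ (w x)) μ := by
  obtain ⟨B, hB⟩ := (isCompact_Icc (a := -M) (b := M)).exists_bound_of_continuousOn hφ.continuousOn
  exact integrable_of_continuous_of_abs_le μ (hφ.comp hw) fun x => hB _ (abs_le.1 (hM x))

lemma continuous_sq_mul_log_sq : Continuous fun y : ℝ => y ^ 2 * log (y ^ 2) :=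
  Real.continuous_mul_log.comp (continuous_pow 2)

lemma ae_eq_zero_of_integral_sq_eq_zero {n : ℕ} {ν : Measure (En n)} {w : En n → ℝ}
    (hi : Integrable (fun x => w x ^ 2) ν) (h : ∫ x, w x ^ 2 ∂ν = 0) : ∀ᵐ x ∂ν, w x = 0 := by
  filter_upwards [(integral_eq_zero_iff_of_nonneg (fun x => sq_nonneg (w x)) hi).1 h] with x hx
  simpa using hx

/-- **Rothaus' lemma** for bounded continuous centered functions. -/
lemma rothaus {n : ℕ} (ν : Measure (En n)) [IsProbabilityMeasure ν] {w : En n → ℝ}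
    (hw : Continuous w) {M : ℝ} (hM : ∀ x, |w x| ≤ M) (hmean : ∫ x, w x ∂ν = 0) (a : ℝ) :
    (∫ x, (a + w x) ^ 2 * log ((a + w x) ^ 2) ∂ν)
        - (∫ x, (a + w x) ^ 2 ∂ν) * log (∫ x, (a + w x) ^ 2 ∂ν)
      ≤ (∫ x, w x ^ 2 * log (w x ^ 2) ∂ν) - (∫ x, w x ^ 2 ∂ν) * log (∫ x, w x ^ 2 ∂ν)
        + 2 * ∫ x, w x ^ 2 ∂ν := by
  have hi : ∀ {φ : ℝ → ℝ}, Continuous φ → Integrable (fun x => φ (w x)) ν := fun hφ =>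
    integrable_comp_of_continuous_of_abs_le ν hw hM hφ
  have hi1 : Integrable w ν := hi continuous_id
  have hi2 : Integrable (fun x => w x ^ 2) ν := hi (continuous_pow 2)
  have hiL : Integrable (fun x => w x ^ 2 * log (w x ^ 2)) ν := hi continuous_sq_mul_log_sq
  have hiaL : Integrable (fun x => (a + w x) ^ 2 * log ((a + w x) ^ 2)) ν :=
    hi (continuous_sq_mul_log_sq.comp (continuous_const.add continuous_id))
  have hv0 : 0 ≤ ∫ x, w x ^ 2 ∂ν := integral_nonneg fun x => sq_nonneg _
  rcases eq_or_ne a 0 with rfl | ha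
  · simp only [zero_add]; linarith
  rcases hv0.eq_or_lt with hv | hv
  · have hz := ae_eq_zero_of_integral_sq_eq_zero hi2 hv.symm
    have e1 : ∫ x, (a + w x) ^ 2 * log ((a + w x) ^ 2) ∂ν = a ^ 2 * log (a ^ 2) := by
      rw [integral_congr_ae (g := fun _ => a ^ 2 * log (a ^ 2))
        (by filter_upwards [hz] with x hx; simp [hx])]
      simp
    have e2 : ∫ x, (a + w x) ^ 2 ∂ν = a ^ 2 := by
      rw [integral_congr_ae (g := fun _ => a ^ 2) (by filter_upwards [hz] with x hx; simp [hx])]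
      simp
    have e3 : ∫ x, w x ^ 2 * log (w x ^ 2) ∂ν = 0 := by
      rw [integral_congr_ae (g := fun _ => 0) (by filter_upwards [hz] with x hx; simp [hx])]
      simp
    rw [e1, e2, e3, ← hv]
    simp
  · have e2 : ∫ x, (a + w x) ^ 2 ∂ν = (∫ x, w x ^ 2 ∂ν) + a ^ 2 := by
      have : ∀ x, (a + w x) ^ 2 = w x ^ 2 + (2 * a) * w x + a ^ 2 := fun x => by ring
      simp_rw [this]
      rw [integral_add (hi2.fun_add (hi1.const_mul _)) (integrable_const _),
        integral_add hi2 (hi1.const_mul _), integral_const_mul, hmean]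
      simp
    obtain ⟨A, B, D, hADv, hp⟩ := rothaus_pointwise ha hv
    have hint := integral_mono hiaL
      (((hiL.fun_add (integrable_const A)).fun_add (hi1.const_mul B)).fun_add (hi2.const_mul D))
      (fun x => hp (w x))
    rw [integral_add ((hiL.fun_add (integrable_const A)).fun_add (hi1.const_mul B))
        (hi2.const_mul D),
      integral_add (hiL.fun_add (integrable_const A)) (hi1.const_mul B),
      integral_add hiL (integrable_const A), integral_const_mul, integral_const_mul, hmean] at hint
    simp only [integral_const, probReal_univ, smul_eq_mul, one_mul, mul_zero, add_zero] at hint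
    rw [e2]
    linarith

/-- The entropy inequality, i.e. the variational formula for the entropy. -/
lemma entropy_inequality {n : ℕ} (ν : Measure (En n)) [IsProbabilityMeasure ν] {w G : En n → ℝ}
    (hw : Continuous w) {M : ℝ} (hM : ∀ x, |w x| ≤ M) {r : ℝ}
    (hwG : Integrable (fun x => w x ^ 2 * G x) ν) (hG : Integrable (fun x => exp (r * G x)) ν) :
    r * (∫ x, w x ^ 2 * G x ∂ν) - (∫ x, w x ^ 2 ∂ν) * log (∫ x, exp (r * G x) ∂ν)
      ≤ (∫ x, w x ^ 2 * log (w x ^ 2) ∂ν) - (∫ x, w x ^ 2 ∂ν) * log (∫ x, w x ^ 2 ∂ν) := by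
  have hi2 : Integrable (fun x => w x ^ 2) ν :=
    integrable_comp_of_continuous_of_abs_le ν hw hM (continuous_pow 2)
  have hiL : Integrable (fun x => w x ^ 2 * log (w x ^ 2)) ν :=
    integrable_comp_of_continuous_of_abs_le ν hw hM continuous_sq_mul_log_sq
  have hv0 : 0 ≤ ∫ x, w x ^ 2 ∂ν := integral_nonneg fun x => sq_nonneg _
  have hZ : 0 < ∫ x, exp (r * G x) ∂ν := integral_exp_pos hG
  rcases hv0.eq_or_lt with hv | hv
  · have hz := ae_eq_zero_of_integral_sq_eq_zero hi2 hv.symm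
    have e1 : ∫ x, w x ^ 2 * G x ∂ν = 0 := by
      rw [integral_congr_ae (g := fun _ => 0) (by filter_upwards [hz] with x hx; simp [hx])]
      simp
    have e3 : ∫ x, w x ^ 2 * log (w x ^ 2) ∂ν = 0 := by
      rw [integral_congr_ae (g := fun _ => 0) (by filter_upwards [hz] with x hx; simp [hx])]
      simp
    rw [e1, e3, ← hv]
    simp
  · set v := ∫ x, w x ^ 2 ∂ν
    set Z := ∫ x, exp (r * G x) ∂ν
    have hp : ∀ x, r * (w x ^ 2 * G x) + (log v - log Z) * w x ^ 2
        ≤ w x ^ 2 * log (w x ^ 2) + v / Z * exp (r * G x) - w x ^ 2 := fun x => by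
      have h := mul_log_add_le (sq_nonneg (w x)) (mul_pos (div_pos hv hZ) (exp_pos (r * G x)))
      rw [Real.log_mul (div_pos hv hZ).ne' (exp_pos _).ne', Real.log_exp,
        Real.log_div hv.ne' hZ.ne'] at h
      linarith
    have hint := integral_mono ((hwG.const_mul r).fun_add (hi2.const_mul (log v - log Z)))
      ((hiL.fun_add (hG.const_mul (v / Z))).sub hi2) hp
    simp only [Pi.sub_apply] at hint
    rw [integral_add (hwG.const_mul r) (hi2.const_mul (log v - log Z)),
      integral_sub (hiL.fun_add (hG.const_mul (v / Z))) hi2,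
      integral_add hiL (hG.const_mul (v / Z)),
      integral_const_mul, integral_const_mul, integral_const_mul] at hint
    change _ + _ * v ≤ _ + _ * Z - v at hint
    rw [div_mul_cancel₀ _ hZ.ne'] at hint
    linarith

lemma log_sobolev_integrand_eq (a y : ℝ) :
    (a * exp (-(1 / 2) * y)) ^ 2 * log ((a * exp (-(1 / 2) * y)) ^ 2)
      = a ^ 2 * log (a ^ 2) * exp (-y) - a ^ 2 * (y * exp (-y)) := by
  have h : exp (-(1 / 2) * y) ^ 2 = exp (-y) := by
    rw [← Real.exp_nat_mul]; congr 1; push_cast; ring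
  rw [mul_pow, h]
  rcases eq_or_ne a 0 with rfl | ha
  · simp
  · rw [Real.log_mul (by positivity) (exp_pos _).ne', Real.log_exp]
    ring

/-- The logarithmic Sobolev inequality for `μ` applied to `f e^{-G/2}` with `G` Lipschitz. -/
lemma LogSobolevLE.weighted {n : ℕ} {μ : Measure (En n)} [IsProbabilityMeasure μ] {C : ℝ}
    (hC : 0 ≤ C) (hLS : LogSobolevLE μ C) {G : En n → ℝ} {K : NNReal} (hG : LipschitzWith K G)
    (hGi : Integrable G μ) {f : En n → ℝ} (hf : IsTestFun f) {θ : ℝ} (hθ : 0 < θ) :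
    (∫ x, f x ^ 2 * log (f x ^ 2) * exp (-G x) ∂μ) - (∫ x, f x ^ 2 * (G x * exp (-G x)) ∂μ)
        - (∫ x, f x ^ 2 * exp (-G x) ∂μ) * log (∫ x, f x ^ 2 * exp (-G x) ∂μ)
      ≤ C * ((1 + θ⁻¹) * (∫ x, ‖fderiv ℝ f x‖ ^ 2 * exp (-G x) ∂μ)
        + (1 + θ) * (K : ℝ) ^ 2 / 4 * ∫ x, f x ^ 2 * exp (-G x) ∂μ) := by
  obtain ⟨h, hh, hK, hdom, hlim⟩ := hG.exists_testFun_tendsto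
  obtain ⟨M, hM⟩ := hf.2.1
  obtain ⟨A, hA⟩ := hf.exists_fderiv_bound
  have hGexp := hLS.integrable_exp_abs hC hG hGi (r := 2) two_pos
  have hconv : ∀ {b : En n → ℝ} {N : ℝ} {φ : ℝ → ℝ}, Continuous b → (∀ x, |b x| ≤ N) →
      Continuous φ → (∀ y, |φ y| ≤ exp (2 * |y|)) →
      (∀ k, Integrable (fun x => b x * φ (h k x)) μ) ∧
      Filter.Tendsto (fun k => ∫ x, b x * φ (h k x) ∂μ) Filter.atTop
        (nhds (∫ x, b x * φ (G x) ∂μ)) := by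
    intro b N φ hb hN hφ hφe
    have hm : ∀ k, AEStronglyMeasurable (fun x => b x * φ (h k x)) μ := fun k =>
      (hb.mul (hφ.comp (hh k).continuous)).aestronglyMeasurable
    have hbd : ∀ k x, ‖b x * φ (h k x)‖ ≤ N * exp (2 * K) * exp (2 * |G x|) := fun k x => by
      rw [norm_mul, mul_assoc, ← Real.exp_add]
      refine mul_le_mul (hN x) ((hφe _).trans (exp_le_exp.2 ?_)) (norm_nonneg _)
        ((abs_nonneg _).trans (hN x))
      linarith [hdom k x]
    have hI := hGexp.const_mul (N * exp (2 * K))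
    exact ⟨fun k => hI.mono' (hm k) (Filter.Eventually.of_forall (hbd k)),
      tendsto_integral_of_dominated_convergence _ hm hI
        (fun k => Filter.Eventually.of_forall (hbd k)) (Filter.Eventually.of_forall fun x =>
          ((hφ.tendsto _).comp (hlim x)).const_mul _)⟩
  have hc1 : Continuous fun y : ℝ => exp (-y) := by fun_prop
  have hc2 : Continuous fun y : ℝ => y * exp (-y) := by fun_prop
  have hb1 : ∀ y : ℝ, |exp (-y)| ≤ exp (2 * |y|) := fun y => by
    rw [abs_of_pos (exp_pos _), exp_le_exp]
    linarith [neg_abs_le y, abs_nonneg y]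
  have hb2 : ∀ y : ℝ, |y * exp (-y)| ≤ exp (2 * |y|) := fun y => by
    rw [abs_mul, abs_of_pos (exp_pos (-y)), two_mul, Real.exp_add]
    exact mul_le_mul (by linarith [Real.add_one_le_exp |y|]) (exp_le_exp.2 (neg_le_abs y))
      (exp_pos _).le (exp_pos _).le
  have hfc := hf.continuous
  obtain ⟨N, hN⟩ := (isCompact_Icc (a := -M) (b := M)).exists_bound_of_continuousOn
    continuous_sq_mul_log_sq.continuousOn
  have cL := hconv (b := fun x => f x ^ 2 * log (f x ^ 2)) (continuous_sq_mul_log_sq.comp hfc)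
    (fun x => hN _ (abs_le.1 (hM x))) hc1 hb1
  have hsq : ∀ x, |f x ^ 2| ≤ M ^ 2 := fun x => by
    rw [abs_pow]; exact pow_le_pow_left₀ (abs_nonneg _) (hM x) 2
  have cS := hconv (b := fun x => f x ^ 2) (hfc.pow 2) hsq hc1 hb1
  have cG := hconv (b := fun x => f x ^ 2) (hfc.pow 2) hsq hc2 hb2
  have cD := hconv (b := fun x => ‖fderiv ℝ f x‖ ^ 2) (hf.continuous_norm_fderiv.pow 2)
    (N := A ^ 2) (fun x => by
    rw [abs_pow, abs_norm]; exact pow_le_pow_left₀ (norm_nonneg _) (hA x) 2) hc1 hb1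
  refine le_of_tendsto_of_tendsto' ((cL.2.sub cG.2).sub
    ((Real.continuous_mul_log.tendsto _).comp cS.2))
    (((cD.2.const_mul (1 + θ⁻¹)).add (cS.2.const_mul ((1 + θ) * (K : ℝ) ^ 2 / 4))).const_mul C)
    fun k => ?_
  have hexp : ∀ x, exp (-(1 / 2) * h k x) ^ 2 = exp (-h k x) := fun x => by
    rw [← Real.exp_nat_mul]; congr 1; push_cast; ring
  have key := hLS _ (hf.mul_exp (hh k) (-(1 / 2)))
  simp only [log_sobolev_integrand_eq] at key
  rw [integral_sub (cL.1 k) (cG.1 k)] at key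
  simp only [mul_pow, hexp] at key
  refine key.trans (mul_le_mul_of_nonneg_left ?_ hC)
  rw [← integral_const_mul, ← integral_const_mul,
    ← integral_add ((cD.1 k).const_mul _) ((cS.1 k).const_mul _)]
  refine integral_mono_of_nonneg (Filter.Eventually.of_forall fun x => by positivity)
    (((cD.1 k).const_mul _).add ((cS.1 k).const_mul _)) (Filter.Eventually.of_forall fun x => ?_)
  change ‖gradient _ x‖ ^ 2 ≤ _
  rw [norm_gradient_eq, hf.fderiv_mul_exp (hh k), norm_smul, mul_pow,
    Real.norm_of_nonneg (exp_pos _).le, hexp]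
  have hn : ‖fderiv ℝ f x + (-(1 / 2) * f x) • fderiv ℝ (h k) x‖
      ≤ ‖fderiv ℝ f x‖ + K / 2 * |f x| := by
    refine (norm_add_le _ _).trans (add_le_add le_rfl ?_)
    rw [norm_smul, norm_mul, Real.norm_eq_abs, Real.norm_eq_abs]
    have := mul_le_mul_of_nonneg_left (hK k x) (abs_nonneg (f x))
    norm_num
    linarith
  have hsqn := pow_le_pow_left₀ (norm_nonneg _) hn 2
  have hyoung : (‖fderiv ℝ f x‖ + K / 2 * |f x|) ^ 2
      ≤ (1 + θ⁻¹) * ‖fderiv ℝ f x‖ ^ 2 + (1 + θ) * (K : ℝ) ^ 2 / 4 * f x ^ 2 := by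
    rw [← sq_abs (f x)]
    have h1 := sq_nonneg (‖fderiv ℝ f x‖ - θ * (K / 2 * |f x|))
    have h2 := mul_nonneg (inv_nonneg.2 hθ.le) h1
    have h3 : θ⁻¹ * (‖fderiv ℝ f x‖ - θ * (K / 2 * |f x|)) ^ 2
        = θ⁻¹ * ‖fderiv ℝ f x‖ ^ 2 - 2 * ‖fderiv ℝ f x‖ * (K / 2 * |f x|)
          + θ * (K / 2 * |f x|) ^ 2 := by
      field_simp
      ring
    nlinarith
  have := mul_le_mul_of_nonneg_left (hsqn.trans hyoung) (exp_pos (-h k x)).le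
  linarith

lemma perturb_eq_tilted {n : ℕ} {μ : Measure (En n)} {G : En n → ℝ}
    (hnorm : ∫ x, exp (-G x) ∂μ = 1) : perturb μ G = μ.tilted fun x => -G x := by
  simp [perturb, Measure.tilted, hnorm]

lemma perturb_congr_ae {n : ℕ} {μ : Measure (En n)} {F G : En n → ℝ} (h : F =ᵐ[μ] G) :
    perturb μ F = perturb μ G := by
  have h1 : (fun x => exp (-F x)) =ᵐ[μ] fun x => exp (-G x) := by
    filter_upwards [h] with x hx
    rw [hx]
  have h2 : (fun x => ENNReal.ofReal (exp (-F x))) =ᵐ[μ] fun x => ENNReal.ofReal (exp (-G x)) := by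
    filter_upwards [h1] with x hx
    rw [hx]
  rw [perturb, perturb, integral_congr_ae h1, withDensity_congr_ae h2]

lemma exists_lipschitzWith_ae_eq {n : ℕ} {μ : Measure (En n)} {F : En n → ℝ} {K : NNReal}
    (hF : LipschitzOnWith K F (measSupport μ)) : ∃ G, LipschitzWith K G ∧ F =ᵐ[μ] G := by
  obtain ⟨G, hG, hFG⟩ := hF.extend_real
  refine ⟨G, hG, ?_⟩
  filter_upwards [μ.support_mem_ae] with x hx
  exact hFG ((Measure.mem_support_iff_forall x).1 hx)

lemma LogSobolevLE.mono {n : ℕ} {μ : Measure (En n)} {C D : ℝ} (h : LogSobolevLE μ C)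
    (hCD : C ≤ D) : LogSobolevLE μ D := fun f hf =>
  (h f hf).trans (mul_le_mul_of_nonneg_right hCD (integral_nonneg fun _ => sq_nonneg _))

/-- The perturbation bound in terms of the parameter `b` of the entropy inequality. -/
lemma LogSobolevLE.perturb_of_lipschitz {n : ℕ} {μ : Measure (En n)} [IsProbabilityMeasure μ]
    {C : ℝ} (hC : 0 ≤ C) (hLS : LogSobolevLE μ C) {G : En n → ℝ} {K : NNReal}
    (hG : LipschitzWith K G) (hGi : Integrable G μ) (hnorm : ∫ x, exp (-G x) ∂μ = 1)
    {P : ℝ} (hPG : PoincareLE (perturb μ G) P) {b θ : ℝ} (hb : 0 < b) (hθ : 0 < θ) :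
    LogSobolevLE (perturb μ G) ((b + 1) * (1 + θ⁻¹) / b * C + P * (2 + ∫ x, G x ∂μ)
      + (K : ℝ) ^ 2 * P * C * ((1 + θ) * (1 + b) / (4 * b) + b / 4)) := by
  intro f hf
  have hei : Integrable (fun x => exp (-G x)) μ := by
    by_contra h
    rw [integral_undef h] at hnorm
    exact zero_ne_one hnorm
  have hI : ∀ u : En n → ℝ, ∫ x, u x ∂(perturb μ G) = ∫ x, u x * exp (-G x) ∂μ := fun u => by
    rw [perturb_eq_tilted hnorm, integral_tilted]
    simp [hnorm, mul_comm]
  have hIi : ∀ u : En n → ℝ, Integrable (fun x => u x * exp (-G x)) μ →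
      Integrable u (perturb μ G) := fun u hu => by
    rw [perturb_eq_tilted hnorm, integrable_tilted_iff hei]
    simpa [mul_comm] using hu
  have hprob : IsProbabilityMeasure (perturb μ G) := by
    rw [perturb_eq_tilted hnorm]
    exact isProbabilityMeasure_tilted hei
  generalize perturb μ G = ν at hI hIi hprob hPG ⊢
  obtain ⟨a, ha⟩ : ∃ a, a = ∫ x, f x ∂ν := ⟨_, rfl⟩
  have hw := hf.sub_const a
  obtain ⟨N, hN⟩ := hf.2.1
  obtain ⟨M, hM⟩ := hw.2.1
  have hwc := hw.continuous
  have hfi : Integrable f ν := integrable_of_continuous_of_abs_le ν hf.continuous hN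
  have hfi2 : Integrable (fun x => f x ^ 2) ν :=
    integrable_comp_of_continuous_of_abs_le ν hf.continuous hN (continuous_pow 2)
  have hmean : ∫ x, (f x - a) ∂ν = 0 := by
    rw [integral_sub hfi (integrable_const _)]
    simp [ha]
  have hvar : ∫ x, (f x - a) ^ 2 ∂ν = ∫ x, f x ^ 2 ∂ν - a ^ 2 := by
    have h : ∀ x, (f x - a) ^ 2 = f x ^ 2 - 2 * a * f x + a ^ 2 := fun x => by ring
    simp_rw [h]
    have hi : Integrable (fun x => f x ^ 2 - 2 * a * f x) ν := hfi2.sub (hfi.const_mul _)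
    rw [integral_add hi (integrable_const _), integral_sub hfi2 (hfi.const_mul _),
      integral_const_mul, ← ha]
    simp
    ring
  have hGe : Integrable (fun x => G x * exp (-G x)) μ := by
    have hGc := hG.continuous
    refine (hLS.integrable_exp_abs hC hG hGi (r := 2) two_pos).mono'
      (Continuous.aestronglyMeasurable (by fun_prop)) (Filter.Eventually.of_forall fun x => ?_)
    rw [Real.norm_eq_abs, abs_mul, abs_of_pos (exp_pos (-G x)), two_mul, Real.exp_add]
    exact mul_le_mul (by linarith [Real.add_one_le_exp |G x|]) (exp_le_exp.2 (neg_le_abs _))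
      (exp_pos _).le (exp_pos _).le
  have hwG : Integrable (fun x => (f x - a) ^ 2 * G x) ν := hIi _ <| by
    simp only [mul_assoc]
    refine hGe.bdd_mul (c := M ^ 2) (hwc.pow 2).aestronglyMeasurable
      (Filter.Eventually.of_forall fun x => ?_)
    rw [norm_pow]
    exact pow_le_pow_left₀ (norm_nonneg _) (hM x) 2
  obtain ⟨hZi, hZ⟩ := hLS.integral_exp_le_of_lipschitz hC hG hGi hb
  have hexp : ∀ x, exp ((1 + b) * G x) * exp (-G x) = exp (b * G x) := fun x => by
    rw [← Real.exp_add]; congr 1; ring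
  have h1 := hLS.weighted hC hG hGi hw hθ
  simp only [fderiv_sub_const, ← mul_assoc] at h1
  simp only [← hI] at h1
  have h2 := entropy_inequality ν hwc hM (r := 1 + b) hwG (hIi _ (by simpa only [hexp] using hZi))
  have h3 := rothaus ν hwc hM hmean a
  simp only [add_sub_cancel] at h3
  have h4 := hPG f hf
  simp only [norm_gradient_eq] at h4 ⊢
  rw [← ha, ← hvar] at h4
  rw [hI fun x => exp ((1 + b) * G x)] at h2
  simp only [hexp] at h2
  have hlog : log (∫ x, exp (b * G x) ∂μ) ≤ b * ∫ x, G x ∂μ + b ^ 2 * (K : ℝ) ^ 2 * C / 4 := by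
    rw [Real.log_le_iff_le_exp (integral_exp_pos hZi)]
    exact hZ
  have hm : 0 ≤ ∫ x, G x ∂μ := by
    have := integral_mono ((integrable_const (1 : ℝ)).sub hGi) hei
      (fun x => by have := Real.add_one_le_exp (-G x); simp only [Pi.sub_apply]; linarith)
    simp only [Pi.sub_apply] at this
    rw [integral_sub (integrable_const _) hGi, hnorm] at this
    simp at this
    exact this
  have hv0 : 0 ≤ ∫ x, (f x - a) ^ 2 ∂ν := integral_nonneg fun x => sq_nonneg _
  set v := ∫ x, (f x - a) ^ 2 ∂ν
  set I := ∫ x, ‖fderiv ℝ f x‖ ^ 2 ∂ν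
  set m := ∫ x, G x ∂μ
  set S := ∫ x, (f x - a) ^ 2 * G x ∂ν
  set T := ∫ x, (f x - a) ^ 2 * log ((f x - a) ^ 2) ∂ν
  have h5 := mul_le_mul_of_nonneg_left hlog hv0
  have h6 : T - v * log v ≤ (1 + b) / b * (C * ((1 + θ⁻¹) * I + (1 + θ) * (K : ℝ) ^ 2 / 4 * v))
      + v * (m + b * (K : ℝ) ^ 2 * C / 4) := by
    rw [div_mul_eq_mul_div, ← sub_le_iff_le_add, le_div_iff₀ hb]
    have h7 := mul_le_mul_of_nonneg_left h1 (by positivity : (0 : ℝ) ≤ 1 + b)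
    linarith
  refine h3.trans ((add_le_add h6 le_rfl).trans ?_)
  have h8 : 0 ≤ (1 + b) / b * C * ((1 + θ) * (K : ℝ) ^ 2 / 4)
      + (m + b * (K : ℝ) ^ 2 * C / 4) + 2 := by
    positivity
  have h9 := mul_le_mul_of_nonneg_left h4 h8
  calc _ = (1 + b) / b * C * (1 + θ⁻¹) * I + ((1 + b) / b * C * ((1 + θ) * (K : ℝ) ^ 2 / 4)
        + (m + b * (K : ℝ) ^ 2 * C / 4) + 2) * v := by ring
    _ ≤ (1 + b) / b * C * (1 + θ⁻¹) * I + ((1 + b) / b * C * ((1 + θ) * (K : ℝ) ^ 2 / 4)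
        + (m + b * (K : ℝ) ^ 2 * C / 4) + 2) * (P * I) := by gcongr
    _ = _ := by field_simp; ring



/-- If `F` is `L`-Lipschitz on the support of `μ`, `μ(e^{-F}) = 1`
and `C_{LS}(μ) < ∞`, then for all `β > 0`, `θ > 0`,
`C_{LS}(μ_F) ≤ ((β+1)(1+θ⁻¹)/β) C_{LS}(μ) + C_P(μ_F)(2 + μ(F))
  + L² C_P(μ_F) C_{LS}(μ) ((1+θ)(1+β)/(4β) + β²/2)`. -/
theorem logSobolev_of_lipschitz_perturbation
    {n : ℕ} (μ : Measure (En n)) [IsProbabilityMeasure μ] (V : En n → ℝ)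
    (hμ : μ = volume.withDensity fun x => ENNReal.ofReal (Real.exp (-V x)))
    (F : En n → ℝ) (L : ℝ) (hL : 0 ≤ L)
    (hFlip : LipschitzOnWith (Real.toNNReal L) F (measSupport μ))
    (hFmeanint : Integrable F μ)
    (hnorm : ∫ x, Real.exp (-F x) ∂μ = 1)
    (Cls : ℝ) (hCls : 0 ≤ Cls) (hLS : LogSobolevLE μ Cls)
    (CPF : ℝ) (hCPF : 0 ≤ CPF) (hPF : PoincareLE (perturb μ F) CPF)
    (β θ : ℝ) (hβ : 0 < β) (hθ : 0 < θ) :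
    LogSobolevLE (perturb μ F)
      ((β + 1) * (1 + θ⁻¹) / β * Cls + CPF * (2 + ∫ x, F x ∂μ)
        + L ^ 2 * CPF * Cls * ((1 + θ) * (1 + β) / (4 * β) + β ^ 2 / 2)) := by
  obtain ⟨G, hG, hFG⟩ := exists_lipschitzWith_ae_eq hFlip
  have hGi : Integrable G μ := hFmeanint.congr hFG
  have hGnorm : ∫ x, exp (-G x) ∂μ = 1 := by
    rw [← hnorm]
    refine integral_congr_ae ?_
    filter_upwards [hFG] with x hx
    rw [hx]
  rw [perturb_congr_ae hFG] at hPF ⊢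
  rw [integral_congr_ae hFG]
  have key := fun b (hb : 0 < b) =>
    hLS.perturb_of_lipschitz hCls hG hGi hGnorm hPF (b := b) hb hθ
  rw [Real.coe_toNNReal L hL] at key
  rcases le_or_gt (1 / 2) β with h | h
  · refine (key β hβ).mono ?_
    have h1 : β / 4 ≤ β ^ 2 / 2 := by nlinarith
    gcongr _ + _ * (_ + ?_)
  · refine (key (1 / 2) (by norm_num)).mono ?_
    have h1 : (1 / 2 + 1) * (1 + θ⁻¹) / (1 / 2) ≤ (β + 1) * (1 + θ⁻¹) / β := by
      rw [div_le_div_iff₀ (by norm_num) hβ]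
      nlinarith [inv_pos.2 hθ]
    have h2 : (1 + θ) * (1 + 1 / 2) / (4 * (1 / 2)) + 1 / 2 / 4
        ≤ (1 + θ) * (1 + β) / (4 * β) + β ^ 2 / 2 := by
      have h3 : (1 + θ) * (1 + β) / (4 * β) = (1 + θ) / 4 * (β⁻¹ + 1) := by
        field_simp
      have h4 : 4 - 4 * β ≤ β⁻¹ := by
        rw [le_inv_comm₀ (by linarith) hβ, inv_eq_one_div, le_div_iff₀ (by linarith)]
        nlinarith [sq_nonneg (2 * β - 1)]
      have h5 : 0 ≤ β⁻¹ - 2 := by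
        rw [sub_nonneg, le_inv_comm₀ (by norm_num) hβ]
        linarith
      rw [h3]
      nlinarith [mul_nonneg hθ.le h5]
    gcongr
end
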